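/- arXiv:2109.03688 — 5 statements merged into one kernel-verified Lean document; each statement's English description precedes it below -/
import Mathlib

section
/- Let {b_{ni}, i ∈ ℤ^d} be real coefficients with Σ_{i∈ℤ^d} (|b_{ni}|/B_n)^α L(B_n/|b_{ni}|) = 1, where L is the truncated second-moment function of an innovation in the domain of attraction of an α-stable law (0 < α ≤ 2, E ξ_0² = ∞). Let p > max{1, α} if 0 < α < 2, and p = 2 if α = 2, and let q satisfy 1/p + 1/q = 1. Define Δ_n = sup_{i∈ℤ^d} |Δ b_{ni}| (supremum of the composed d-fold increments) and ρ_n = sup_{i∈ℤ^d} |b_{ni}|/B_n. Then there is a constant C, independent of n, such that ρ_n ≤ C · 2^d · [ (Δ_n/B_n)^{1/(dp+1)} + Δ_n/B_n ]. In particular, Δ_n = o(B_n) implies ρ_n → 0. -/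
open MeasureTheory Filter Topology

noncomputable section

/-- `|x|^α L(1/|x|)`, with the convention that it is `0` at `x = 0`.
Note that for `x > 0`, `wgt L α (b/x) = (|b|/x)^α L(x/|b|)`. -/
def wgt (L : ℝ → ℝ) (α x : ℝ) : ℝ :=
  if x = 0 then 0 else |x| ^ α * L (1 / |x|)

/-- A function is slowly varying at infinity. -/
def SlowlyVarying (L : ℝ → ℝ) : Prop :=
  ∀ c : ℝ, 0 < c → Tendsto (fun x => L (c * x) / L x) atTop (nhds 1)

/-- The composed `d`-fold increment `Δ = Δ_1 ∘ ⋯ ∘ Δ_d` of a collection of coefficients. -/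
def ddelta {d : ℕ} (b : (Fin d → ℤ) → ℝ) (i : Fin d → ℤ) : ℝ :=
  ∑ ε : Fin d → Bool, (-1 : ℝ) ^ (Finset.univ.filter fun k => ε k = true).card *
    b (fun k => i k - if ε k then 1 else 0)

lemma aux_phi {d : ℕ} (x : (Fin d → ℤ) → ℝ) (i v : Fin d → ℤ) (s : ℤ) :
    (Finsupp.linearCombination ℝ (fun w : Fin d → ℤ => x (i - w)))
      (AddMonoidAlgebra.coeff ((AddMonoidAlgebra.single v (1:ℝ) * ∏ k : Fin d, (1 - AddMonoidAlgebra.single (Pi.single k s : Fin d → ℤ) (1:ℝ)) :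
        AddMonoidAlgebra ℝ (Fin d → ℤ)))) =
    ∑ ε : Fin d → Bool, (-1 : ℝ) ^ (Finset.univ.filter fun k => ε k = true).card *
      x (fun k => (i k - v k) - if ε k then s else 0) := by
  have h1 : ∀ k : Fin d, (1 - AddMonoidAlgebra.single (Pi.single k s : Fin d → ℤ) (1:ℝ) :
      AddMonoidAlgebra ℝ (Fin d → ℤ)) =
      ∑ e : Bool, AddMonoidAlgebra.single (Pi.single k (if e then s else 0) : Fin d → ℤ)
        (if e then (-1:ℝ) else 1) := by
    intro k
    simp [AddMonoidAlgebra.one_def, AddMonoidAlgebra.single_neg]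
    abel
  have h2 : ∀ ε : Fin d → Bool, ∏ k : Fin d, (AddMonoidAlgebra.single
      (Pi.single k (if ε k then s else 0) : Fin d → ℤ) (if ε k then (-1:ℝ) else 1) :
        AddMonoidAlgebra ℝ (Fin d → ℤ)) =
      AddMonoidAlgebra.single (fun k => if ε k then s else 0)
        ((-1 : ℝ) ^ (Finset.univ.filter fun k => ε k = true).card) := by
    intro ε
    have := AddMonoidAlgebra.prod_single (R := ℝ) (s := Finset.univ)
      (m := fun k : Fin d => (Pi.single k (if ε k then s else 0) : Fin d → ℤ))
      (r := fun k => (if ε k then (-1:ℝ) else 1))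
    rw [this]
    congr 1
    · exact Finset.univ_sum_single (fun k => if ε k then s else 0)
    · rw [Finset.prod_ite]; simp
  simp_rw [h1]
  rw [Finset.prod_univ_sum]
  simp_rw [h2]
  rw [Finset.mul_sum]
  simp only [AddMonoidAlgebra.single_mul_single]
  rw [Fintype.piFinset_univ]
  simp only [AddMonoidAlgebra.coeff_sum, map_sum, one_mul, AddMonoidAlgebra.coeff_single, Finsupp.linearCombination_single, smul_eq_mul]
  refine Finset.sum_congr rfl fun ε _ => ?_
  congr 2
  ext k
  simp; ring

lemma aux_key {d : ℕ} (x : (Fin d → ℤ) → ℝ) (D : ℝ) (hD : ∀ i, |ddelta x i| ≤ D)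
    (t : ℕ) (i : Fin d → ℤ) :
    |∑ ε : Fin d → Bool, (-1 : ℝ) ^ (Finset.univ.filter fun k => ε k = true).card *
      x (fun k => i k - if ε k then (t : ℤ) else 0)| ≤ (t : ℝ) ^ d * D := by
  have h0 := aux_phi x i 0 (t : ℤ)
  simp only [Pi.zero_apply, sub_zero] at h0
  rw [← h0]
  have h1 : ∀ k : Fin d, (1 - AddMonoidAlgebra.single (Pi.single k (t:ℤ) : Fin d → ℤ) (1:ℝ) :
      AddMonoidAlgebra ℝ (Fin d → ℤ)) =
      (∑ j ∈ Finset.range t, AddMonoidAlgebra.single (Pi.single k (j:ℤ) : Fin d → ℤ) (1:ℝ)) *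
      (1 - AddMonoidAlgebra.single (Pi.single k (1:ℤ) : Fin d → ℤ) (1:ℝ)) := by
    intro k
    have h := geom_sum_mul_neg
      (AddMonoidAlgebra.single (Pi.single k (1:ℤ) : Fin d → ℤ) (1:ℝ) :
        AddMonoidAlgebra ℝ (Fin d → ℤ)) t
    have hp : ∀ j : ℕ, (AddMonoidAlgebra.single (Pi.single k (1:ℤ) : Fin d → ℤ) (1:ℝ) :
        AddMonoidAlgebra ℝ (Fin d → ℤ)) ^ j = AddMonoidAlgebra.single (Pi.single k (j:ℤ)) 1 := by
      intro j
      rw [AddMonoidAlgebra.single_pow, ← Pi.single_smul]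
      simp
    simp only [hp] at h
    exact h.symm
  have h2 : (AddMonoidAlgebra.single (0 : Fin d → ℤ) (1:ℝ) * ∏ k : Fin d,
      (1 - AddMonoidAlgebra.single (Pi.single k (t:ℤ) : Fin d → ℤ) (1:ℝ)) :
        AddMonoidAlgebra ℝ (Fin d → ℤ)) =
      ∑ f ∈ Fintype.piFinset (fun _ : Fin d => Finset.range t),
        AddMonoidAlgebra.single (fun k => (f k : ℤ)) (1:ℝ) * ∏ k : Fin d,
          (1 - AddMonoidAlgebra.single (Pi.single k (1:ℤ) : Fin d → ℤ) (1:ℝ)) := by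
    rw [← AddMonoidAlgebra.one_def, one_mul]
    simp_rw [h1]
    rw [Finset.prod_mul_distrib, Finset.prod_univ_sum, Finset.sum_mul]
    refine Finset.sum_congr rfl fun f _ => ?_
    congr 1
    rw [AddMonoidAlgebra.prod_single]
    congr 1
    · exact Finset.univ_sum_single (fun k => (f k : ℤ))
    · simp
  rw [h2, AddMonoidAlgebra.coeff_sum, map_sum]
  refine (Finset.abs_sum_le_sum_abs _ _).trans ?_
  refine (Finset.sum_le_card_nsmul _ _ D fun f _ => ?_).trans ?_
  · have := hD (fun k => i k - f k)
    unfold ddelta at this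
    rw [← aux_phi x i (fun k => (f k : ℤ)) 1] at this
    exact this
  · simp [Fintype.card_piFinset]

lemma aux_avg {d : ℕ} (x : (Fin d → ℤ) → ℝ) (D p K : ℝ) (hp : 1 ≤ p) (hD0 : 0 ≤ D) (hK : 0 ≤ K)
    (hD : ∀ i, |ddelta x i| ≤ D) (hS : ∀ s : Finset (Fin d → ℤ), ∑ j ∈ s, |x j| ^ p ≤ K)
    (m : ℕ) (hm : 1 ≤ m) (i : Fin d → ℤ) :
    |x i| ≤ (m : ℝ) ^ d * D + 2 ^ d * (K ^ (1 / p) * (m : ℝ) ^ (-(1 / p))) := by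
  have hp0 : 0 < p := by linarith
  have hm0 : (0:ℝ) < m := by exact_mod_cast hm
  let P : ℕ → (Fin d → Bool) → (Fin d → ℤ) := fun t ε k => i k - if ε k then (t : ℤ) else 0
  let ε0 : Fin d → Bool := fun _ => false
  have h1 : ∀ t ∈ Finset.Icc 1 m, |x i| ≤ (m:ℝ)^d * D +
      ∑ ε ∈ Finset.univ.erase ε0, |x (P t ε)| := by
    intro t ht
    rw [Finset.mem_Icc] at ht
    have hk := aux_key x D hD t i
    rw [← Finset.add_sum_erase _ _ (Finset.mem_univ ε0)] at hk
    have e0 : (-1 : ℝ) ^ (Finset.univ.filter fun k => ε0 k = true).card *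
      x (fun k => i k - if ε0 k then (t : ℤ) else 0) = x i := by simp [ε0]
    rw [e0] at hk
    have hle : |∑ ε ∈ Finset.univ.erase ε0, (-1 : ℝ) ^ (Finset.univ.filter fun k => ε k = true).card *
      x (fun k => i k - if ε k then (t : ℤ) else 0)| ≤ ∑ ε ∈ Finset.univ.erase ε0, |x (P t ε)| := by
      refine (Finset.abs_sum_le_sum_abs _ _).trans (Finset.sum_le_sum fun ε _ => ?_)
      rw [abs_mul, abs_pow]; simp [P]
    have hmt : (t:ℝ)^d * D ≤ (m:ℝ)^d * D := by
      gcongr; exact ht.2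
    have := abs_sub_abs_le_abs_sub (x i) (-∑ ε ∈ Finset.univ.erase ε0, (-1 : ℝ) ^ (Finset.univ.filter fun k => ε k = true).card *
      x (fun k => i k - if ε k then (t : ℤ) else 0))
    rw [sub_neg_eq_add, abs_neg] at this
    linarith
  have h2 : ∀ ε ∈ Finset.univ.erase ε0, ∑ t ∈ Finset.Icc 1 m, |x (P t ε)| ≤
      (m:ℝ) * (K ^ (1 / p) * (m : ℝ) ^ (-(1 / p))) := by
    intro ε hε
    have hne : ε ≠ ε0 := (Finset.mem_erase.1 hε).1
    obtain ⟨k, hk⟩ := Function.ne_iff.1 hne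
    have hk' : ε k = true := by simpa [ε0] using hk
    have hinj : Function.Injective (fun t => P t ε) := by
      intro a c hac
      have := congrFun hac k
      simp [P, hk'] at this
      exact this
    have hh := Real.rpow_sum_le_const_mul_sum_rpow (Finset.Icc 1 m) (fun t => x (P t ε)) hp
    have hs : ∑ t ∈ Finset.Icc 1 m, |x (P t ε)| ^ p ≤ K := by
      have := hS ((Finset.Icc 1 m).map ⟨_, hinj⟩)
      rwa [Finset.sum_map] at this
    have hS0 : 0 ≤ ∑ t ∈ Finset.Icc 1 m, |x (P t ε)| := Finset.sum_nonneg fun _ _ => abs_nonneg _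
    have h3 : (∑ t ∈ Finset.Icc 1 m, |x (P t ε)|) ^ p ≤ (m:ℝ)^(p-1) * K := by
      refine hh.trans ?_
      simp only [Nat.card_Icc, Nat.add_sub_cancel]
      gcongr
    have h4 := Real.rpow_le_rpow (by positivity) h3 (by positivity : 0 ≤ 1 / p)
    rw [← Real.rpow_mul hS0, mul_one_div_cancel hp0.ne', Real.rpow_one,
      Real.mul_rpow (by positivity) hK, ← Real.rpow_mul hm0.le] at h4
    refine h4.trans (le_of_eq ?_)
    have : (p - 1) * (1 / p) = 1 + -(1/p) := by field_simp; ring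
    rw [this, Real.rpow_add hm0, Real.rpow_one]; ring
  have h5 := Finset.sum_le_sum h1
  rw [Finset.sum_add_distrib, Finset.sum_comm] at h5
  have h6 := Finset.sum_le_sum h2
  simp only [Finset.sum_const, Nat.card_Icc, Nat.add_sub_cancel, nsmul_eq_mul] at h5 h6
  have hc : ((Finset.univ.erase ε0).card : ℝ) ≤ 2 ^ d := by
    have : (Finset.univ.erase ε0).card ≤ (Finset.univ : Finset (Fin d → Bool)).card :=
      Finset.card_erase_le
    simp at this
    calc ((Finset.univ.erase ε0).card : ℝ) ≤ ((2^d : ℕ) : ℝ) := by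
          exact_mod_cast (by simpa using this)
      _ = _ := by push_cast; rfl
  have hc2 : ((Finset.univ.erase ε0).card : ℝ) * ((m:ℝ) * (K ^ (1 / p) * (m : ℝ) ^ (-(1 / p)))) ≤
      2 ^ d * ((m:ℝ) * (K ^ (1 / p) * (m : ℝ) ^ (-(1 / p)))) := by gcongr
  refine le_of_mul_le_mul_left (a := (m:ℝ)) ?_ hm0
  calc (m:ℝ) * |x i| ≤ _ := h5
    _ ≤ (m:ℝ) * ((m:ℝ)^d*D) + 2 ^ d * ((m:ℝ) * (K ^ (1 / p) * (m : ℝ) ^ (-(1 / p)))) := by linarith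
    _ = _ := by ring

lemma aux_opt_pos {d : ℕ} (x : (Fin d → ℤ) → ℝ) (D p K : ℝ) (hp : 1 ≤ p) (hD0 : 0 < D)
    (hK : 0 ≤ K)
    (hD : ∀ i, |ddelta x i| ≤ D) (hS : ∀ s : Finset (Fin d → ℤ), ∑ j ∈ s, |x j| ^ p ≤ K)
    (i : Fin d → ℤ) :
    |x i| ≤ (1 + K ^ (1 / p)) * 2 ^ d * (D ^ (1 / ((d:ℝ) * p + 1)) + D) := by
  have hp0 : 0 < p := by linarith
  have hK' : 0 ≤ K ^ (1/p) := Real.rpow_nonneg hK _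
  have hE : 0 ≤ D ^ (1 / ((d:ℝ) * p + 1)) := Real.rpow_nonneg hD0.le _
  have h2d : (1:ℝ) ≤ 2 ^ d := one_le_pow₀ (by norm_num)
  have hden : 0 < (d:ℝ) * p + 1 := by positivity
  rcases le_or_gt 1 D with h | h
  · have := aux_avg x D p K hp hD0.le hK hD hS 1 le_rfl i
    simp only [Nat.cast_one, one_pow, one_mul, Real.one_rpow, mul_one] at this
    have e1 : D ≤ 2 ^ d * D := le_mul_of_one_le_left hD0.le h2d
    have e2 : 2 ^ d * K ^ (1/p) ≤ 2 ^ d * K ^ (1/p) * D := le_mul_of_one_le_right (by positivity) h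
    have e3 : 0 ≤ (1 + K ^ (1 / p)) * 2 ^ d * (D ^ (1 / ((d:ℝ) * p + 1))) := by positivity
    nlinarith
  · set u : ℝ := D ^ (-(p / ((d:ℝ) * p + 1))) with hu
    have hu1 : 1 ≤ u := Real.one_le_rpow_of_pos_of_le_one_of_nonpos hD0 h.le
      (by rw [neg_nonpos]; positivity)
    have hm1 : 1 ≤ ⌈u⌉₊ := Nat.one_le_ceil_iff.2 (by linarith)
    have hA := aux_avg x D p K hp hD0.le hK hD hS ⌈u⌉₊ hm1 i
    have hmle : (⌈u⌉₊ : ℝ) ≤ 2 * u := by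
      have := (Nat.ceil_lt_add_one (by linarith : 0 ≤ u)).le
      linarith
    have hmge : u ≤ (⌈u⌉₊ : ℝ) := Nat.le_ceil u
    have e1 : (⌈u⌉₊ : ℝ) ^ d * D ≤ 2 ^ d * D ^ (1 / ((d:ℝ) * p + 1)) := by
      calc (⌈u⌉₊ : ℝ) ^ d * D ≤ (2 * u) ^ d * D := by gcongr
        _ = 2 ^ d * (u ^ d * D) := by ring
        _ = _ := by
          congr 1
          rw [hu, ← Real.rpow_natCast, ← Real.rpow_mul hD0.le]
          nth_rewrite 2 [← Real.rpow_one D]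
          rw [← Real.rpow_add hD0]
          congr 1
          field_simp
          ring
    have e2 : (⌈u⌉₊ : ℝ) ^ (-(1/p)) ≤ D ^ (1 / ((d:ℝ) * p + 1)) := by
      calc (⌈u⌉₊ : ℝ) ^ (-(1/p)) ≤ u ^ (-(1/p)) :=
            Real.rpow_le_rpow_of_nonpos (by linarith) hmge (by rw [neg_nonpos]; positivity)
        _ = _ := by
          rw [hu, ← Real.rpow_mul hD0.le]
          congr 1
          field_simp
    have e3 : 2 ^ d * (K ^ (1 / p) * (⌈u⌉₊ : ℝ) ^ (-(1 / p))) ≤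
      2 ^ d * (K ^ (1 / p) * D ^ (1 / ((d:ℝ) * p + 1))) := by gcongr
    have e4 : 0 ≤ (1 + K ^ (1 / p)) * 2 ^ d * D := by positivity
    nlinarith

lemma aux_opt {d : ℕ} (x : (Fin d → ℤ) → ℝ) (D p K : ℝ) (hp : 1 ≤ p) (hD0 : 0 ≤ D)
    (hK : 0 ≤ K)
    (hD : ∀ i, |ddelta x i| ≤ D) (hS : ∀ s : Finset (Fin d → ℤ), ∑ j ∈ s, |x j| ^ p ≤ K)
    (i : Fin d → ℤ) :
    |x i| ≤ (1 + K ^ (1 / p)) * 2 ^ d * (D ^ (1 / ((d:ℝ) * p + 1)) + D) := by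
  have hp0 : 0 < p := by linarith
  have hden : 0 ≤ 1 / ((d:ℝ) * p + 1) := by positivity
  have hc : Continuous fun y : ℝ => (1 + K ^ (1 / p)) * 2 ^ d * (y ^ (1 / ((d:ℝ) * p + 1)) + y) :=
    continuous_const.mul ((Real.continuous_rpow_const hden).add continuous_id)
  refine ge_of_tendsto (hc.continuousWithinAt (s := Set.Ioi D) (x := D)) ?_
  filter_upwards [self_mem_nhdsWithin] with y hy
  exact aux_opt_pos x y p K hp (lt_of_le_of_lt hD0 hy) hK (fun i => (hD i).trans (le_of_lt hy)) hS i

lemma aux_potter (α : ℝ) (hα : 0 < α) (hα2 : α < 2) (L : ℝ → ℝ) (hsv : SlowlyVarying L)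
    (hLpos : ∀ x : ℝ, 0 < x → 0 < L x) (bL : ℝ) (hbL : 1 ≤ bL)
    (hlow : ∀ x : ℝ, 0 < x → (max bL x) ^ (α - 2) * (2 - α) / α ≤ L x) (δ : ℝ) (hδ : 0 < δ) :
    ∃ c : ℝ, 0 < c ∧ ∀ y, 1 ≤ y → c ≤ y ^ δ * L y := by
  have hev : ∀ᶠ x in atTop, (2:ℝ) ^ (-δ) < L (2 * x) / L x :=
    (hsv 2 (by norm_num)).eventually_const_lt
      (Real.rpow_lt_one_of_one_lt_of_neg (by norm_num) (by linarith))
  obtain ⟨x1, hx1⟩ := eventually_atTop.1 hev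
  set x0 := max x1 bL with hx0
  have hx0b : bL ≤ x0 := le_max_right _ _
  have hx01 : 1 ≤ x0 := hbL.trans hx0b
  have hstep : ∀ y, x0 ≤ y → y ^ δ * L y ≤ (2 * y) ^ δ * L (2 * y) := by
    intro y hy
    have hy0 : 0 < y := by linarith
    have h := hx1 y ((le_max_left _ _).trans hy)
    rw [lt_div_iff₀ (hLpos y hy0)] at h
    rw [Real.mul_rpow (by norm_num) hy0.le]
    have h2 : (2:ℝ)^δ * (2:ℝ)^(-δ) = 1 := by rw [← Real.rpow_add (by norm_num)]; simp
    calc y ^ δ * L y = (2 ^ δ * 2 ^ (-δ)) * (y ^ δ * L y) := by rw [h2, one_mul]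
      _ = 2 ^ δ * y ^ δ * (2 ^ (-δ) * L y) := by ring
      _ ≤ _ := by gcongr
  refine ⟨(2 * x0) ^ (α - 2) * (2 - α) / α, ?_, ?_⟩
  · have : 0 < 2 - α := by linarith
    positivity
  have hn : ∀ n : ℕ, ∀ y, 1 ≤ y → y ≤ 2 ^ n * (2 * x0) →
      (2 * x0) ^ (α - 2) * (2 - α) / α ≤ y ^ δ * L y := by
    intro n
    induction n with
    | zero =>
      intro y hy hy2
      have hy0 : 0 < y := by linarith
      have h1 := hlow y hy0
      have h2 : (2 * x0) ^ (α - 2) ≤ (max bL y) ^ (α - 2) :=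
        Real.rpow_le_rpow_of_nonpos (by positivity)
          (max_le (by linarith) (by linarith)) (by linarith)
      have h3 : 1 ≤ y ^ δ := Real.one_le_rpow hy hδ.le
      have h4 : 0 ≤ 2 - α := by linarith
      calc (2 * x0) ^ (α - 2) * (2 - α) / α ≤ (max bL y) ^ (α - 2) * (2 - α) / α := by gcongr
        _ ≤ L y := h1
        _ ≤ _ := le_mul_of_one_le_left (hLpos y hy0).le h3
    | succ n ih =>
      intro y hy hy2
      rcases le_or_gt y (2 * x0) with h | h
      · refine ih y hy (h.trans ?_)
        exact le_mul_of_one_le_left (by linarith) (one_le_pow₀ (by norm_num))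
      · have h1 := ih (y / 2) (by linarith) (by rw [pow_succ] at hy2; linarith)
        have h2 := hstep (y / 2) (by linarith)
        rw [mul_div_cancel₀ y (by norm_num : (2:ℝ) ≠ 0)] at h2
        exact h1.trans h2
  intro y hy
  obtain ⟨n, hn'⟩ := pow_unbounded_of_one_lt y (by norm_num : (1:ℝ) < 2)
  refine hn n y hy (hn'.le.trans ?_)
  exact le_mul_of_one_le_right (by positivity) (by linarith)

lemma aux_wgt (α : ℝ) (hα : 0 < α) (hα2 : α ≤ 2)
    (L : ℝ → ℝ) (hsv : SlowlyVarying L) (hLpos : ∀ x : ℝ, 0 < x → 0 < L x)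
    (bL : ℝ) (hbL : 1 ≤ bL)
    (hconst : ∀ x : ℝ, 0 < x → x ≤ bL → L x = L bL)
    (hlow : (α < 2 → ∀ x : ℝ, 0 < x → (max bL x) ^ (α - 2) * (2 - α) / α ≤ L x) ∧
      (α = 2 → ∀ x : ℝ, 0 < x → 1 ≤ L x))
    (p : ℝ)
    (hp : (α < 2 → max 1 α < p) ∧ (α = 2 → p = 2)) :
    ∃ c : ℝ, 0 < c ∧ ∀ x, wgt L α x ≤ 1 → c * |x| ^ p ≤ wgt L α x := by
  rcases hα2.lt_or_eq with h | h
  · have hp' := hp.1 h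
    have hpα : α < p := (le_max_right _ _).trans_lt hp'
    have hp1 : 1 < p := (le_max_left _ _).trans_lt hp'
    obtain ⟨c, hc, hcy⟩ := aux_potter α hα h L hsv hLpos bL hbL (hlow.1 h) (p - α) (by linarith)
    have hLb := hLpos bL (by linarith)
    set M := (1 / L bL) ^ (1 / α) with hM
    have hM0 : 0 < M := by positivity
    refine ⟨min c (L bL / M ^ (p - α)), by positivity, ?_⟩
    intro x hx
    unfold wgt at hx ⊢
    split_ifs at hx ⊢ with h0
    · rw [h0, abs_zero, Real.zero_rpow (by linarith)]; simp
    have hx0 : 0 < |x| := abs_pos.2 h0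
    have hsplit : |x| ^ p = |x| ^ α * |x| ^ (p - α) := by
      rw [← Real.rpow_add hx0]; congr 1; ring
    rcases le_or_gt |x| 1 with h1 | h1
    · have := hcy (1 / |x|) (by rw [le_div_iff₀ hx0]; linarith)
      rw [Real.div_rpow zero_le_one hx0.le, Real.one_rpow, div_mul_eq_mul_div, one_mul,
        le_div_iff₀ (by positivity)] at this
      calc min c (L bL / M ^ (p - α)) * |x| ^ p ≤ c * |x| ^ p := by gcongr; exact min_le_left _ _
        _ = |x| ^ α * (c * |x| ^ (p - α)) := by rw [hsplit]; ring
        _ ≤ _ := by gcongr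
    · have hL : L (1 / |x|) = L bL := hconst _ (by positivity)
        (le_trans (by rw [div_le_one hx0]; exact h1.le) hbL)
      rw [hL] at hx ⊢
      have hxM : |x| ≤ M := by
        have : |x| ^ α ≤ 1 / L bL := by rwa [le_div_iff₀ hLb]
        have h2 := Real.rpow_le_rpow (by positivity) this (by positivity : 0 ≤ 1 / α)
        rwa [← Real.rpow_mul hx0.le, mul_one_div_cancel hα.ne', Real.rpow_one] at h2
      have h3 : |x| ^ (p - α) ≤ M ^ (p - α) := Real.rpow_le_rpow hx0.le hxM (by linarith)
      calc min c (L bL / M ^ (p - α)) * |x| ^ p ≤ (L bL / M ^ (p - α)) * |x| ^ p := by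
            gcongr; exact min_le_right _ _
        _ = |x| ^ α * ((L bL / M ^ (p - α)) * |x| ^ (p - α)) := by rw [hsplit]; ring
        _ ≤ |x| ^ α * ((L bL / M ^ (p - α)) * M ^ (p - α)) := by gcongr
        _ = _ := by rw [div_mul_cancel₀]; positivity
  · refine ⟨1, one_pos, fun x _ => ?_⟩
    rw [hp.2 h]
    unfold wgt
    split_ifs with h0
    · simp [h0]
    · rw [one_mul, h]
      exact le_mul_of_one_le_right (by positivity) (hlow.2 h _ (by positivity))

/-- Lemma `lemmarho`, inequality (rho1):
`ρ_n ≪ 2^d [(Δ_n/B_n)^{1/(dp+1)} + Δ_n/B_n]`, so `Δ_n = o(B_n)` implies `ρ_n → 0`. -/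
theorem stmt11
    {d : ℕ} (hd : 0 < d)
    (α : ℝ) (hα : 0 < α) (hα2 : α ≤ 2)
    -- `L` is the truncated second-moment function of an innovation in the domain of
    -- attraction of an α-stable law, with the properties used in the proof:
    (L : ℝ → ℝ) (hsv : SlowlyVarying L) (hLpos : ∀ x : ℝ, 0 < x → 0 < L x)
    (bL : ℝ) (hbL : 1 ≤ bL)
    (hconst : ∀ x : ℝ, 0 < x → x ≤ bL → L x = L bL)
    (hlow : (α < 2 → ∀ x : ℝ, 0 < x → (max bL x) ^ (α - 2) * (2 - α) / α ≤ L x) ∧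
      (α = 2 → ∀ x : ℝ, 0 < x → 1 ≤ L x))
    (hmono : ∀ x y : ℝ, 0 < x → x ≤ y → x ^ (2 - α) * L x ≤ y ^ (2 - α) * L y)
    (p q : ℝ)
    (hp : (α < 2 → max 1 α < p) ∧ (α = 2 → p = 2))
    (hq : 1 / p + 1 / q = 1)
    (b : ℕ → (Fin d → ℤ) → ℝ)
    (B : ℕ → ℝ) (hB1 : ∀ n, 1 ≤ B n)
    -- the normalization `Σ_i (|b_{ni}|/B_n)^α L(B_n/|b_{ni}|) = 1`
    (hsum : ∀ n, Summable (fun i => wgt L α (b n i / B n)))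
    (hnorm : ∀ n, ∑' i, wgt L α (b n i / B n) = 1)
    -- `Δ_n` is an upper bound for the composed increments: `Δ_n = sup_i |Δ b_{ni}|`
    (Δ : ℕ → ℝ) (hΔ0 : ∀ n, 0 ≤ Δ n)
    (hΔ : ∀ n i, |ddelta (b n) i| ≤ Δ n) :
    (∃ C : ℝ, 0 < C ∧ ∀ n i,
      |b n i| / B n ≤ C * 2 ^ d * ((Δ n / B n) ^ (1 / ((d : ℝ) * p + 1)) + Δ n / B n)) ∧
    (Tendsto (fun n => Δ n / B n) atTop (nhds 0) →
      ∀ ε : ℝ, 0 < ε → ∃ N : ℕ, ∀ n ≥ N, ∀ i, |b n i| ≤ ε * B n) := by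
  obtain ⟨c, hc, hcw⟩ := aux_wgt α hα hα2 L hsv hLpos bL hbL hconst hlow p hp
  have hp1 : 1 ≤ p := by
    rcases hα2.lt_or_eq with h | h
    · exact ((le_max_left _ _).trans_lt (hp.1 h)).le
    · rw [hp.2 h]; norm_num
  have hwn : ∀ x, 0 ≤ wgt L α x := by
    intro x
    unfold wgt
    split_ifs with h0
    · exact le_rfl
    · have := hLpos (1 / |x|) (by positivity)
      positivity
  have hK : 0 ≤ 1 / c := by positivity
  have main : ∀ n i, |b n i| / B n ≤ (1 + (1 / c) ^ (1 / p)) * 2 ^ d *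
      ((Δ n / B n) ^ (1 / ((d : ℝ) * p + 1)) + Δ n / B n) := by
    intro n i
    have hB0 : 0 < B n := by linarith [hB1 n]
    have hfin : ∀ s : Finset (Fin d → ℤ), ∑ j ∈ s, wgt L α (b n j / B n) ≤ 1 := fun s =>
      hnorm n ▸ (hsum n).sum_le_tsum s (fun j _ => hwn _)
    have hone : ∀ j, wgt L α (b n j / B n) ≤ 1 := fun j => by simpa using hfin {j}
    have := aux_opt (fun j => b n j / B n) (Δ n / B n) p (1 / c) hp1
      (div_nonneg (hΔ0 n) hB0.le) hK ?_ ?_ i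
    · simpa [abs_div, abs_of_pos hB0] using this
    · intro j
      have e : ddelta (fun j => b n j / B n) j = ddelta (b n) j / B n := by
        unfold ddelta
        rw [Finset.sum_div]
        exact Finset.sum_congr rfl fun _ _ => by ring
      rw [e, abs_div, abs_of_pos hB0]
      exact div_le_div_of_nonneg_right (hΔ n j) hB0.le
    · intro s
      rw [le_div_iff₀ hc, mul_comm, Finset.mul_sum]
      exact (Finset.sum_le_sum fun j _ => hcw _ (hone j)).trans (hfin s)
  refine ⟨⟨_, by positivity, main⟩, ?_⟩
  intro hT ε hε
  have hden : 0 < 1 / ((d:ℝ) * p + 1) := by positivity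
  have hcont : Continuous fun y : ℝ => (1 + (1 / c) ^ (1 / p)) * 2 ^ d *
      (y ^ (1 / ((d:ℝ) * p + 1)) + y) :=
    continuous_const.mul ((Real.continuous_rpow_const hden.le).add continuous_id)
  have hlim := (hcont.tendsto 0).comp hT
  simp only [Real.zero_rpow hden.ne', add_zero, mul_zero] at hlim
  obtain ⟨N, hN⟩ := eventually_atTop.1 (hlim.eventually_lt_const hε)
  refine ⟨N, fun n hn i => ?_⟩
  have hB0 : 0 < B n := by linarith [hB1 n]
  rw [← div_le_iff₀ hB0]
  exact (main n i).trans (hN n hn).le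

end
end

section
/- Let {a_i, i ∈ ℤ^d} be real coefficients with ‖a‖_p = (Σ_{i∈ℤ^d} |a_i|^p)^{1/p} < ∞ for some p > 1, and let q satisfy 1/p + 1/q = 1. Let Γ_n^d be a disjoint union of J_n discrete rectangles in ℤ^d and set b_{ni} = Σ_{j∈Γ_n^d} a_{j−i}. Then the supremum of the composed d-fold increments satisfies Δ_n = sup_{i∈ℤ^d} |Δ b_{ni}| ≤ 2^d · J_n^{1/q} · ‖a‖_p. -/
open Filter Topology

noncomputable section

/-- A discrete rectangle `Π_{l=1}^d [lo_l, hi_l] ∩ ℤ^d` (with `lo_l ≤ hi_l`). -/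
def IsDiscreteRect {d : ℕ} (R : Finset (Fin d → ℤ)) : Prop :=
  ∃ lo hi : Fin d → ℤ, (∀ l, lo l ≤ hi l) ∧
    R = Fintype.piFinset fun l => Finset.Icc (lo l) (hi l)

/-- `Γ` is a pairwise disjoint union of `J` discrete rectangles. -/
def IsRectUnion {d : ℕ} (Γ : Finset (Fin d → ℤ)) (J : ℕ) : Prop :=
  ∃ R : Fin J → Finset (Fin d → ℤ), (∀ k, IsDiscreteRect (R k)) ∧
    (∀ k l, k ≠ l → Disjoint (R k) (R l)) ∧ Γ = Finset.univ.biUnion R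

def corner {d : ℕ} (lo hi : Fin d → ℤ) (ε : Fin d → Bool) : Fin d → ℤ :=
  fun l => if ε l then hi l + 1 else lo l

def sgn (e : Bool) : ℝ := if e then -1 else 1

theorem sgn_pow {d : ℕ} (ε : Fin d → Bool) :
    (-1 : ℝ) ^ (Finset.univ.filter fun k => ε k = true).card = ∏ l, sgn (ε l) := by
  unfold sgn
  rw [Finset.prod_ite]
  simp

theorem expand_delta {d : ℕ} (f : (Fin d → ℤ) → ℝ) (B : Finset (Fin d → ℤ))
    (x : Fin d → ℤ) (hx : x ∈ B) :
    f x = ∑ y ∈ B, f y * ∏ l, (if x l = y l then (1 : ℝ) else 0) := by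
  have h : ∀ y, (∏ l, (if x l = y l then (1 : ℝ) else 0)) = if x = y then 1 else 0 := by
    intro y
    rw [Finset.prod_ite_zero]
    simp [funext_iff]
  simp [h, hx]

theorem tele_one (lo hi : ℤ) (h : lo ≤ hi) (g : ℤ → ℝ) :
    ∑ e : Bool, ∑ j ∈ Finset.Icc lo hi, sgn e * g (j + if e then 1 else 0)
      = ∑ e : Bool, sgn e * g (if e then hi + 1 else lo) := by
  simp only [Fintype.sum_bool, sgn]
  simp
  induction hi, h using Int.le_induction with
  | base => simp
  | succ n hn ih =>
    have : Finset.Icc lo (n + 1) = insert (n + 1) (Finset.Icc lo n) := by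
      ext x; simp; omega
    rw [this, Finset.sum_insert (by simp), Finset.sum_insert (by simp)]
    linarith

theorem tele {d : ℕ} (lo hi : Fin d → ℤ) (h : ∀ l, lo l ≤ hi l) (f : (Fin d → ℤ) → ℝ) :
    ∑ ε : Fin d → Bool, (∏ l, sgn (ε l)) *
      ∑ j ∈ Fintype.piFinset fun l => Finset.Icc (lo l) (hi l),
        f (fun k => j k + if ε k then 1 else 0)
      = ∑ ε : Fin d → Bool, (∏ l, sgn (ε l)) * f (corner lo hi ε) := by
  set B := Fintype.piFinset fun l => Finset.Icc (lo l) (hi l + 1) with hB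
  have e1 : ∀ ε : Fin d → Bool, ∀ j ∈ Fintype.piFinset fun l => Finset.Icc (lo l) (hi l),
      f (fun k => j k + if ε k then 1 else 0) =
      ∑ y ∈ B, f y * ∏ l, (if j l + (if ε l then 1 else 0) = y l then (1 : ℝ) else 0) := by
    intro ε j hj
    apply expand_delta f B
    simp only [hB, Fintype.mem_piFinset, Finset.mem_Icc] at hj ⊢
    intro l
    have := hj l
    split_ifs <;> omega
  have e2 : ∀ ε : Fin d → Bool, f (corner lo hi ε) =
      ∑ y ∈ B, f y * ∏ l, (if (if ε l then hi l + 1 else lo l) = y l then (1 : ℝ) else 0) := by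
    intro ε
    apply expand_delta f B
    simp only [hB, Fintype.mem_piFinset, Finset.mem_Icc, corner]
    intro l
    have := h l
    split_ifs <;> omega
  have key : ∀ y : Fin d → ℤ,
      ∑ ε : Fin d → Bool, ∑ j ∈ Fintype.piFinset fun l => Finset.Icc (lo l) (hi l),
        ∏ l, (sgn (ε l) * (if j l + (if ε l then 1 else 0) = y l then (1 : ℝ) else 0))
      = ∑ ε : Fin d → Bool,
        ∏ l, (sgn (ε l) * (if (if ε l then hi l + 1 else lo l) = y l then (1 : ℝ) else 0)) := by
    intro y
    have a1 : ∀ ε : Fin d → Bool, ∑ j ∈ Fintype.piFinset fun l => Finset.Icc (lo l) (hi l),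
        ∏ l, (sgn (ε l) * (if j l + (if ε l then 1 else 0) = y l then (1 : ℝ) else 0))
        = ∏ l, ∑ j ∈ Finset.Icc (lo l) (hi l),
          (sgn (ε l) * (if j + (if ε l then 1 else 0) = y l then (1 : ℝ) else 0)) := by
      intro ε
      rw [Finset.prod_univ_sum]
    simp only [a1]
    have a2 := Fintype.prod_sum (fun (l : Fin d) (e : Bool) => ∑ j ∈ Finset.Icc (lo l) (hi l),
          (sgn e * (if j + (if e then 1 else 0) = y l then (1 : ℝ) else 0)))
    have a3 := Fintype.prod_sum (fun (l : Fin d) (e : Bool) =>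
          (sgn e * (if (if e then hi l + 1 else lo l) = y l then (1 : ℝ) else 0)))
    rw [← a2, ← a3]
    refine Finset.prod_congr rfl fun l _ => ?_
    exact tele_one (lo l) (hi l) (h l) (fun z => if z = y l then (1 : ℝ) else 0)
  have l1 : ∀ ε : Fin d → Bool, (∏ l, sgn (ε l)) *
      ∑ j ∈ Fintype.piFinset fun l => Finset.Icc (lo l) (hi l),
        f (fun k => j k + if ε k then 1 else 0) =
      ∑ y ∈ B, f y * ∑ j ∈ Fintype.piFinset fun l => Finset.Icc (lo l) (hi l),
        ∏ l, (sgn (ε l) * (if j l + (if ε l then 1 else 0) = y l then (1 : ℝ) else 0)) := by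
    intro ε
    rw [Finset.sum_congr rfl (e1 ε), Finset.sum_comm, Finset.mul_sum]
    refine Finset.sum_congr rfl fun y _ => ?_
    rw [Finset.mul_sum, Finset.mul_sum]
    refine Finset.sum_congr rfl fun j _ => ?_
    rw [Finset.prod_mul_distrib]
    ring
  have l2 : ∀ ε : Fin d → Bool, (∏ l, sgn (ε l)) * f (corner lo hi ε) =
      ∑ y ∈ B, f y *
        ∏ l, (sgn (ε l) * (if (if ε l then hi l + 1 else lo l) = y l then (1 : ℝ) else 0)) := by
    intro ε
    rw [e2 ε, Finset.mul_sum]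
    refine Finset.sum_congr rfl fun y _ => ?_
    rw [Finset.prod_mul_distrib]
    ring
  rw [Finset.sum_congr rfl fun ε _ => l1 ε, Finset.sum_congr rfl fun ε _ => l2 ε,
    Finset.sum_comm, Finset.sum_comm (s := Finset.univ) (t := B)]
  refine Finset.sum_congr rfl fun y _ => ?_
  rw [← Finset.mul_sum, ← Finset.mul_sum, key y]

theorem holder_inj {ι : Type*} (p q : ℝ) (hpq : p.HolderConjugate q) (a : ι → ℝ)
    (hap : Summable (fun i => |a i| ^ p)) (J : ℕ) (c : Fin J → ι) (hc : Function.Injective c) :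
    ∑ k, |a (c k)| ≤ (J : ℝ) ^ (1 / q) * (∑' i, |a i| ^ p) ^ (1 / p) := by
  have h := Real.inner_le_Lp_mul_Lq Finset.univ (fun k => |a (c k)|) (fun _ : Fin J => (1 : ℝ)) hpq
  simp only [mul_one, abs_abs, abs_one, Real.one_rpow, Finset.sum_const, Finset.card_univ,
    Fintype.card_fin, nsmul_eq_mul] at h
  refine h.trans ?_
  rw [mul_comm]
  have h0 : ∀ i, 0 ≤ |a i| ^ p := fun i => Real.rpow_nonneg (abs_nonneg _) _
  have h2 : ∑ k, |a (c k)| ^ p ≤ ∑' i, |a i| ^ p := by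
    have := hap.sum_le_tsum (Finset.univ.map ⟨c, hc⟩) (fun i _ => h0 i)
    simpa using this
  refine mul_le_mul_of_nonneg_left ?_ (Real.rpow_nonneg (Nat.cast_nonneg _) _)
  exact Real.rpow_le_rpow (Finset.sum_nonneg fun k _ => h0 _) h2 (one_div_nonneg.2 hpq.nonneg)

/-- Lemma `lemmarho`, inequality (Eq:Delta):
`Δ_n = sup_i |Δ b_{ni}| ≤ 2^d J_n^{1/q} ‖a‖_p`. -/
theorem stmt12
    {d : ℕ} (hd : 0 < d)
    (p q : ℝ) (hp : 1 < p) (hq : 1 / p + 1 / q = 1)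
    (a : (Fin d → ℤ) → ℝ)
    (hap : Summable (fun i => |a i| ^ p))
    (J : ℕ) (Γ : Finset (Fin d → ℤ)) (hΓ : IsRectUnion Γ J)
    (b : (Fin d → ℤ) → ℝ) (hb : ∀ i, b i = ∑ j ∈ Γ, a (j - i)) :
    ∀ i, |ddelta b i| ≤ 2 ^ d * (J : ℝ) ^ (1 / q) * (∑' i, |a i| ^ p) ^ (1 / p) := by
  intro i
  have hpq : p.HolderConjugate q := by
    rw [Real.holderConjugate_iff]
    exact ⟨hp, by simpa [one_div] using hq⟩
  obtain ⟨R, hR, hdis, rfl⟩ := hΓ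
  choose lo hi hle hRe using hR
  have hinj : ∀ ε : Fin d → Bool, Function.Injective fun k => corner (lo k) (hi k) ε - i := by
    intro ε k k' hkk
    by_contra hne
    have hc : corner (lo k) (hi k) ε = corner (lo k') (hi k') ε := by simpa using hkk
    have hmem : ∀ m, (fun l => corner (lo m) (hi m) ε l - if ε l then 1 else 0) ∈ R m := by
      intro m
      rw [hRe m]
      simp only [Fintype.mem_piFinset, Finset.mem_Icc, corner]
      intro l
      have := hle m l
      split_ifs <;> omega
    have h1 := hmem k
    rw [hc] at h1
    exact Finset.disjoint_left.1 (hdis k k' hne) h1 (hmem k')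
  have hdd : ddelta b i = ∑ k, ∑ ε : Fin d → Bool,
      (∏ l, sgn (ε l)) * a (corner (lo k) (hi k) ε - i) := by
    have : ∀ k, ∑ ε : Fin d → Bool, (∏ l, sgn (ε l)) * a (corner (lo k) (hi k) ε - i) =
        ∑ ε : Fin d → Bool, (∏ l, sgn (ε l)) * ∑ j ∈ R k,
          a (j - fun k => i k - if ε k then 1 else 0) := by
      intro k
      rw [← tele (lo k) (hi k) (hle k) (fun x => a (x - i)), ← hRe k]
      refine Finset.sum_congr rfl fun ε _ => ?_
      congr 1
      refine Finset.sum_congr rfl fun j _ => ?_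
      congr 1
      ext l
      simp only [Pi.sub_apply]
      ring
    rw [Finset.sum_congr rfl fun k _ => this k, Finset.sum_comm]
    unfold ddelta
    refine Finset.sum_congr rfl fun ε _ => ?_
    rw [sgn_pow, hb, Finset.sum_biUnion (fun k _ l _ hkl => hdis k l hkl), Finset.mul_sum]
  have habs : ∀ ε : Fin d → Bool, |∏ l, sgn (ε l)| = 1 := by
    intro ε
    rw [← sgn_pow]
    simp
  rw [hdd, Finset.sum_comm]
  calc |∑ ε : Fin d → Bool, ∑ k, (∏ l, sgn (ε l)) * a (corner (lo k) (hi k) ε - i)|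
      ≤ ∑ ε : Fin d → Bool, ∑ k, |a (corner (lo k) (hi k) ε - i)| := by
        refine (Finset.abs_sum_le_sum_abs _ _).trans (Finset.sum_le_sum fun ε _ => ?_)
        refine (Finset.abs_sum_le_sum_abs _ _).trans (Finset.sum_le_sum fun k _ => ?_)
        rw [abs_mul, habs, one_mul]
    _ ≤ ∑ ε : Fin d → Bool, (J : ℝ) ^ (1 / q) * (∑' i, |a i| ^ p) ^ (1 / p) :=
        Finset.sum_le_sum fun ε _ => holder_inj p q hpq a hap J _ (hinj ε)
    _ = _ := by
        simp [mul_assoc]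

end
end

section
/- Let X_j = Σ_{i∈ℤ^d} a_i ξ_{j−i} be a linear random field with Σ_{i∈ℤ^d} |a_i|^p < ∞, where p > max{1,α} if 0 < α < 2 and p = 2 if α = 2, and 1/p + 1/q = 1. Let S_n = Σ_{j∈Γ_n^d} X_j where Γ_n^d is a disjoint union of J_n discrete rectangles, b_{ni} = Σ_{j∈Γ_n^d} a_{j−i}, B_n defined by Σ_i (|b_{ni}|/B_n)^α L(B_n/|b_{ni}|) = 1, and ρ_n = sup_i |b_{ni}|/B_n. Then there is a constant C independent of n such that ρ_n ≤ C·[ 2^d (J_n^{1/q}/B_n)^{1/(dp+1)} + 2^{2d} J_n^{1/q}/B_n ]. In particular, J_n = o(B_n^q) implies ρ_n → 0 as n → ∞. -/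
open MeasureTheory Filter Topology

noncomputable section

/-- indicator of an integer interval -/
def uu (lo hi x : ℤ) : ℝ := if lo ≤ x ∧ x ≤ hi then 1 else 0

lemma uu_step (lo hi x : ℤ) (h : lo ≤ hi) :
    |uu lo hi x - uu lo hi (x + 1)| ≤ ∑ σ : Bool, if x = (if σ then hi else lo - 1) then (1:ℝ) else 0 := by
  simp only [Fintype.sum_bool, uu]
  simp only [if_true, Bool.false_eq_true, if_false]
  split_ifs <;> first | (exfalso; omega) | norm_num

lemma uu_diff (lo hi x : ℤ) (h : lo ≤ hi) (t : ℕ) :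
    |uu lo hi x - uu lo hi (x + t)| ≤
      ∑ s ∈ Finset.range t ×ˢ (Finset.univ : Finset Bool),
        if x = (if s.2 then hi else lo - 1) - s.1 then (1:ℝ) else 0 := by
  rw [Finset.sum_product]
  induction t with
  | zero => simp
  | succ t ih =>
    rw [Finset.sum_range_succ]
    have h1 := uu_step lo hi (x + t) h
    have h2 : ∀ σ : Bool, (x + (t:ℤ) = (if σ then hi else lo - 1)) ↔ (x = (if σ then hi else lo - 1) - (t:ℤ)) := by
      intro σ; constructor <;> intro h <;> omega
    simp only [h2] at h1
    have h3 : x + ((t + 1 : ℕ) : ℤ) = x + t + 1 := by push_cast; ring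
    rw [h3]
    calc _ ≤ _ := abs_sub_le _ (uu lo hi (x + t)) _
      _ ≤ _ := add_le_add ih h1

/-- shift vector -/
def sh {d : ℕ} (t : ℕ) (e : Fin d → Bool) : Fin d → ℤ := fun l => if e l then (t:ℤ) else 0

/-- sign -/
def sg {d : ℕ} (e : Fin d → Bool) : ℝ := ∏ l, if e l then (-1:ℝ) else 1

lemma abs_sg {d : ℕ} (e : Fin d → Bool) : |sg e| = 1 := by
  unfold sg
  rw [Finset.abs_prod]
  apply Finset.prod_eq_one
  intro l _
  split_ifs <;> simp

lemma prod_uu {d : ℕ} (lo hi x : Fin d → ℤ) :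
    ∏ l, uu (lo l) (hi l) (x l) =
      if x ∈ Fintype.piFinset (fun l => Finset.Icc (lo l) (hi l)) then 1 else 0 := by
  simp only [Fintype.mem_piFinset, Finset.mem_Icc]
  split_ifs with h
  · apply Finset.prod_eq_one
    intro l _
    simp [uu, h l]
  · push Not at h
    obtain ⟨l, hl⟩ := h
    apply Finset.prod_eq_zero (Finset.mem_univ l)
    unfold uu
    rw [if_neg]
    rintro ⟨h1, h2⟩
    have := hl h1
    omega

lemma sg_prod {d : ℕ} (lo hi x : Fin d → ℤ) (t : ℕ) :
    ∑ e : Fin d → Bool, sg e * ∏ l, uu (lo l) (hi l) ((x + sh t e) l) =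
      ∏ l, (uu (lo l) (hi l) (x l) - uu (lo l) (hi l) (x l + t)) := by
  have h : ∀ l, uu (lo l) (hi l) (x l) - uu (lo l) (hi l) (x l + t) =
      ∑ σ : Bool, (if σ then (-1:ℝ) else 1) * uu (lo l) (hi l) (x l + if σ then (t:ℤ) else 0) := by
    intro l
    simp
    ring
  simp only [h]
  rw [Finset.prod_univ_sum, Fintype.piFinset_univ]
  apply Finset.sum_congr rfl
  intro e _
  rw [Finset.prod_mul_distrib]
  simp [sg, sh]

lemma rect_bound {d : ℕ} (a : (Fin d → ℤ) → ℝ) (lo hi i : Fin d → ℤ) (h : ∀ l, lo l ≤ hi l) (t : ℕ) :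
    |∑ e : Fin d → Bool, sg e *
      ∑ j ∈ Fintype.piFinset (fun l => Finset.Icc (lo l) (hi l)), a (j - (i + sh t e))| ≤
    ∑ f ∈ Fintype.piFinset (fun _ : Fin d => Finset.range t ×ˢ (Finset.univ : Finset Bool)),
      |a (fun l => (if (f l).2 then hi l else lo l - 1) - (f l).1 - i l)| := by
  classical
  set R := Fintype.piFinset (fun l => Finset.Icc (lo l) (hi l)) with hR
  set W : Finset (Fin d → ℤ) := Finset.univ.biUnion
    (fun e : Fin d → Bool => R.image (fun j => j - (i + sh t e))) with hW
  have h1 : ∀ e : Fin d → Bool, ∑ j ∈ R, a (j - (i + sh t e)) =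
      ∑ m ∈ W, a m * ∏ l, uu (lo l) (hi l) ((m + i + sh t e) l) := by
    intro e
    simp only [prod_uu, ← hR, mul_ite, mul_one, mul_zero]
    rw [← Finset.sum_filter]
    apply Finset.sum_bij' (fun j _ => j - (i + sh t e)) (fun m _ => m + i + sh t e)
    · intro j hj
      simp only [Finset.mem_filter, hW, Finset.mem_biUnion, Finset.mem_image, Finset.mem_univ, true_and]
      refine ⟨⟨e, j, hj, rfl⟩, ?_⟩
      convert hj using 1
      abel
    · intro m hm
      exact (Finset.mem_filter.mp hm).2
    · intro j _; abel
    · intro j _; abel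
    · intro j _; rfl
  simp only [h1, Finset.mul_sum]
  rw [Finset.sum_comm]
  have h2 : ∀ m ∈ W, ∑ e : Fin d → Bool, sg e * (a m * ∏ l, uu (lo l) (hi l) ((m + i + sh t e) l)) =
      a m * ∏ l, (uu (lo l) (hi l) ((m + i) l) - uu (lo l) (hi l) ((m + i) l + t)) := by
    intro m _
    rw [← sg_prod, Finset.mul_sum]
    apply Finset.sum_congr rfl
    intro e _
    ring
  rw [Finset.sum_congr rfl h2]
  calc _ ≤ ∑ m ∈ W, |a m * ∏ l, (uu (lo l) (hi l) ((m + i) l) - uu (lo l) (hi l) ((m + i) l + t))| :=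
        Finset.abs_sum_le_sum_abs _ _
    _ ≤ ∑ m ∈ W, ∑ f ∈ Fintype.piFinset (fun _ : Fin d => Finset.range t ×ˢ (Finset.univ : Finset Bool)),
        (if m = (fun l => (if (f l).2 then hi l else lo l - 1) - (f l).1 - i l) then |a m| else 0) := by
        apply Finset.sum_le_sum
        intro m _
        rw [abs_mul, Finset.abs_prod]
        calc _ ≤ |a m| * ∏ l, ∑ s ∈ Finset.range t ×ˢ (Finset.univ : Finset Bool),
                if (m + i) l = (if s.2 then hi l else lo l - 1) - s.1 then (1:ℝ) else 0 := by
              gcongr with l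
              exact uu_diff _ _ _ (h l) t
          _ = _ := by
              rw [Finset.prod_univ_sum, Finset.mul_sum]
              apply Finset.sum_congr rfl
              intro f _
              split_ifs with hm
              · rw [Finset.prod_eq_one, mul_one]
                intro l _
                rw [if_pos]
                have := congrFun hm l
                simp only [Pi.add_apply]
                omega
              · have : ∃ l, m l ≠ (if (f l).2 then hi l else lo l - 1) - (f l).1 - i l := by
                  by_contra hc
                  push Not at hc
                  exact hm (funext hc)
                obtain ⟨l, hl⟩ := this
                rw [Finset.prod_eq_zero (Finset.mem_univ l), mul_zero]
                rw [if_neg]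
                simp only [Pi.add_apply]
                omega
    _ ≤ _ := by
        rw [Finset.sum_comm]
        apply Finset.sum_le_sum
        intro f _
        rw [Finset.sum_ite_eq']
        split_ifs
        · exact le_rfl
        · positivity

lemma holder_card {ι : Type*} (s : Finset ι) (f : ι → ℝ) (p q A : ℝ) (hp : 1 < p)
    (hq : 1 / p + 1 / q = 1) (hA : ∑ i ∈ s, |f i| ^ p ≤ A) :
    ∑ i ∈ s, |f i| ≤ (s.card : ℝ) ^ (1 / q) * A ^ (1 / p) := by
  have hp0 : 0 < p := by linarith
  have h := Real.rpow_sum_le_const_mul_sum_rpow s f hp.le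
  have h0 : 0 ≤ ∑ i ∈ s, |f i| := Finset.sum_nonneg fun _ _ => abs_nonneg _
  have hS0 : 0 ≤ ∑ i ∈ s, |f i| ^ p := Finset.sum_nonneg fun _ _ => by positivity
  have h3 : (∑ i ∈ s, |f i|) = ((∑ i ∈ s, |f i|) ^ p) ^ (1 / p) := by
    rw [← Real.rpow_mul h0, mul_one_div_cancel hp0.ne', Real.rpow_one]
  have hqe : 1 / q = (p - 1) * (1 / p) := by
    have : (p - 1) * (1 / p) = 1 - 1 / p := by field_simp
    linarith
  have hc0 : (0:ℝ) ≤ (s.card : ℝ) := Nat.cast_nonneg _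
  rw [h3, hqe, Real.rpow_mul hc0, ← Real.mul_rpow (Real.rpow_nonneg hc0 _) (hS0.trans hA)]
  apply Real.rpow_le_rpow (Real.rpow_nonneg h0 _) _ (one_div_nonneg.mpr hp0.le)
  exact h.trans (mul_le_mul_of_nonneg_left hA (Real.rpow_nonneg hc0 _))

lemma mixed_bound {d : ℕ} (a : (Fin d → ℤ) → ℝ) (p q : ℝ) (hp : 1 < p) (hq : 1 / p + 1 / q = 1)
    (hap : Summable (fun i => |a i| ^ p)) (Γ : Finset (Fin d → ℤ)) (J : ℕ) (hΓ : IsRectUnion Γ J)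
    (i : Fin d → ℤ) (t : ℕ) :
    |∑ e : Fin d → Bool, sg e * ∑ j ∈ Γ, a (j - (i + sh t e))| ≤
      ((t:ℝ) * 2) ^ d * ((J:ℝ) ^ (1 / q) * (∑' i, |a i| ^ p) ^ (1 / p)) := by
  classical
  obtain ⟨R, hR, hdis, rfl⟩ := hΓ
  choose lo hi hlh hRe using hR
  have h1 : ∀ e : Fin d → Bool, ∑ j ∈ Finset.univ.biUnion R, a (j - (i + sh t e)) =
      ∑ k, ∑ j ∈ R k, a (j - (i + sh t e)) := by
    intro e
    apply Finset.sum_biUnion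
    intro k _ l _ hkl
    exact hdis k l hkl
  simp only [h1, Finset.mul_sum (s := (Finset.univ : Finset (Fin J)))]
  rw [Finset.sum_comm]
  calc _ ≤ ∑ k, |∑ e : Fin d → Bool, sg e * ∑ j ∈ R k, a (j - (i + sh t e))| :=
        Finset.abs_sum_le_sum_abs _ _
    _ ≤ ∑ k, ∑ f ∈ Fintype.piFinset (fun _ : Fin d => Finset.range t ×ˢ (Finset.univ : Finset Bool)),
          |a (fun l => (if (f l).2 then hi k l else lo k l - 1) - (f l).1 - i l)| := by
        apply Finset.sum_le_sum
        intro k _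
        rw [hRe k]
        exact rect_bound a (lo k) (hi k) i (hlh k) t
    _ ≤ ∑ f ∈ Fintype.piFinset (fun _ : Fin d => Finset.range t ×ˢ (Finset.univ : Finset Bool)),
          ((J:ℝ) ^ (1 / q) * (∑' i, |a i| ^ p) ^ (1 / p)) := by
        rw [Finset.sum_comm]
        apply Finset.sum_le_sum
        intro f _
        have hinj : Function.Injective (fun (k : Fin J) => (fun l : Fin d => (if (f l).2 then hi k l else lo k l - 1) - ((f l).1 : ℤ) - i l)) := by
          intro k k' hk
          by_contra hne
          have hD := hdis k k' hne
          rw [Finset.disjoint_left] at hD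
          apply @hD (fun l => if (f l).2 then hi k l else lo k l)
          · rw [hRe]
            simp only [Fintype.mem_piFinset, Finset.mem_Icc]
            intro l
            have := hlh k l
            split_ifs <;> omega
          · rw [hRe]
            simp only [Fintype.mem_piFinset, Finset.mem_Icc]
            intro l
            have h1 := hlh k' l
            have h2 := congrFun hk l
            simp only at h2
            split_ifs at h2 ⊢ <;> omega
        have := holder_card (Finset.univ : Finset (Fin J))
          (fun k => a (fun l => (if (f l).2 then hi k l else lo k l - 1) - ((f l).1:ℤ) - i l)) p q
          (∑' i, |a i| ^ p) hp hq (by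
            have := hap.sum_le_tsum (Finset.univ.image (fun (k : Fin J) => (fun l : Fin d => (if (f l).2 then hi k l else lo k l - 1) - ((f l).1 : ℤ) - i l)))
              (fun x _ => Real.rpow_nonneg (abs_nonneg (a x)) p)
            rwa [Finset.sum_image (fun x _ y _ h => hinj h)] at this)
        simpa using this
    _ = _ := by
        rw [Finset.sum_const, nsmul_eq_mul, Fintype.card_piFinset]
        simp

lemma sh_zero {d : ℕ} (t : ℕ) : sh t (fun _ : Fin d => false) = 0 := by
  ext l; simp [sh]

lemma sg_zero {d : ℕ} : sg (fun _ : Fin d => false) = 1 := by simp [sg]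

lemma corner_bound {d : ℕ} (β : (Fin d → ℤ) → ℝ) (i : Fin d → ℤ) (t : ℕ) (D : ℝ)
    (hD : |∑ e : Fin d → Bool, sg e * β (i + sh t e)| ≤ D) :
    |β i| ≤ D + ∑ e ∈ (Finset.univ.erase (fun _ : Fin d => false)), |β (i + sh t e)| := by
  classical
  rw [← Finset.add_sum_erase _ _ (Finset.mem_univ (fun _ : Fin d => false)), sg_zero, sh_zero,
    add_zero, one_mul] at hD
  have h2 : |∑ e ∈ Finset.univ.erase (fun _ : Fin d => false), sg e * β (i + sh t e)| ≤
      ∑ e ∈ (Finset.univ.erase (fun _ : Fin d => false)), |β (i + sh t e)| := by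
    refine (Finset.abs_sum_le_sum_abs _ _).trans (le_of_eq ?_)
    apply Finset.sum_congr rfl
    intro e _
    rw [abs_mul, abs_sg, one_mul]
  set S := ∑ e ∈ Finset.univ.erase (fun _ : Fin d => false), sg e * β (i + sh t e)
  have h3 : β i = (β i + S) - S := by ring
  calc |β i| = |(β i + S) - S| := by rw [← h3]
    _ ≤ |β i + S| + |S| := abs_sub _ _
    _ ≤ _ := add_le_add hD h2

lemma avg_bound {d : ℕ} (β : (Fin d → ℤ) → ℝ) (p q M D : ℝ) (hp : 1 < p) (hq : 1 / p + 1 / q = 1)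
    (hM : ∀ s : Finset (Fin d → ℤ), ∑ i ∈ s, |β i| ^ p ≤ M) (hD0 : 0 ≤ D)
    (hD : ∀ i (t : ℕ), |∑ e : Fin d → Bool, sg e * β (i + sh t e)| ≤ (t:ℝ) ^ d * D)
    (K : ℕ) (hK : 0 < K) (i : Fin d → ℤ) :
    |β i| ≤ (K:ℝ) ^ d * D + 2 ^ d * ((K:ℝ) ^ (-(1 / p)) * M ^ (1 / p)) := by
  classical
  have hM0 : 0 ≤ M := by simpa using hM ∅
  have hKr : (0:ℝ) < K := by exact_mod_cast hK
  have h1 : ∀ t ∈ Finset.Icc 1 K, |β i| ≤ (K:ℝ) ^ d * D +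
      ∑ e ∈ (Finset.univ.erase (fun _ : Fin d => false)), |β (i + sh t e)| := by
    intro t ht
    apply corner_bound
    refine (hD i t).trans ?_
    have : (t:ℝ) ≤ K := by exact_mod_cast (Finset.mem_Icc.mp ht).2
    gcongr
  have h2 := Finset.sum_le_sum h1
  rw [Finset.sum_add_distrib, Finset.sum_const, Finset.sum_const, Finset.sum_comm] at h2
  simp only [Nat.card_Icc, Nat.add_sub_cancel, nsmul_eq_mul] at h2
  have h3 : ∀ e ∈ (Finset.univ.erase (fun _ : Fin d => false)), ∑ t ∈ Finset.Icc 1 K, |β (i + sh t e)| ≤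
      (K:ℝ) ^ (1 / q) * M ^ (1 / p) := by
    intro e he
    have he' : e ≠ fun _ => false := Finset.ne_of_mem_erase he
    have : ∃ l, e l = true := by
      by_contra hc
      push Not at hc
      apply he'
      funext l
      simpa using hc l
    obtain ⟨l, hl⟩ := this
    have hinj : Function.Injective (fun t : ℕ => i + sh t e) := by
      intro t t' h
      have := congrFun h l
      simpa [sh, hl] using this
    have := holder_card (Finset.Icc 1 K) (fun t => β (i + sh t e)) p q M hp hq (by
      have := hM ((Finset.Icc 1 K).image (fun t : ℕ => i + sh t e))
      rwa [Finset.sum_image (fun x _ y _ h => hinj h)] at this)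
    simpa using this
  have h4 := Finset.sum_le_sum h3
  rw [Finset.sum_const, nsmul_eq_mul] at h4
  have hcard : (((Finset.univ.erase (fun _ : Fin d => false)).card : ℕ) : ℝ) ≤ 2 ^ d := by
    have : (Finset.univ.erase (fun _ : Fin d => false)).card ≤ 2 ^ d := by
      refine (Finset.card_erase_le).trans ?_
      simp
    exact_mod_cast this
  have h5 : (K:ℝ) * |β i| ≤ K * (K ^ d * D) + 2 ^ d * ((K:ℝ) ^ (1 / q) * M ^ (1 / p)) := by
    refine h2.trans (add_le_add le_rfl (h4.trans ?_))
    gcongr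
  have h6 : (K:ℝ) ^ (1 / q) = K * (K:ℝ) ^ (-(1 / p)) := by
    have : 1 / q = 1 + -(1/p) := by linarith
    rw [this, Real.rpow_add hKr, Real.rpow_one]
  rw [h6] at h5
  refine le_of_mul_le_mul_left ?_ hKr
  linarith

lemma g_low (L : ℝ → ℝ) (α p y0 : ℝ) (hsv : SlowlyVarying L) (hLpos : ∀ x : ℝ, 0 < x → 0 < L x)
    (hlow : α = 2 → ∀ x : ℝ, 0 < x → 1 ≤ L x) (hα2 : α ≤ 2)
    (hmono : ∀ x y : ℝ, 0 < x → x ≤ y → x ^ (2 - α) * L x ≤ y ^ (2 - α) * L y)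
    (hp : (α < 2 → α < p) ∧ (α = 2 → p = 2)) (hy0 : 0 < y0) :
    ∃ c : ℝ, 0 < c ∧ ∀ y, y0 ≤ y → c ≤ y ^ (p - α) * L y := by
  rcases hα2.eq_or_lt with h2 | h2
  · refine ⟨1, one_pos, fun y hy => ?_⟩
    rw [hp.2 h2, h2]
    simpa using hlow h2 y (hy0.trans_le hy)
  · have hpα := hp.1 h2
    have hlt : (2:ℝ) ^ (-(p - α)) < 1 :=
      Real.rpow_lt_one_of_one_lt_of_neg (by norm_num) (by linarith)
    have hev := (hsv 2 two_pos).eventually (lt_mem_nhds hlt)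
    obtain ⟨x1, hx1⟩ := eventually_atTop.mp hev
    set x0 := max x1 y0 with hx0
    have hx0p : 0 < x0 := hy0.trans_le (le_max_right _ _)
    have hdouble : ∀ y, x0 ≤ y → y ^ (p - α) * L y ≤ (2 * y) ^ (p - α) * L (2 * y) := by
      intro y hy
      have hyp : 0 < y := hx0p.trans_le hy
      have h3 := hx1 y ((le_max_left _ _).trans hy)
      rw [lt_div_iff₀ (hLpos y hyp)] at h3
      rw [Real.mul_rpow (by norm_num) hyp.le]
      have h4 : (2:ℝ) ^ (p - α) * (2:ℝ) ^ (-(p - α)) = 1 := by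
        rw [← Real.rpow_add two_pos]; simp
      have h5 : (2:ℝ) ^ (p - α) * ((2:ℝ) ^ (-(p - α)) * L y) ≤ (2:ℝ) ^ (p - α) * L (2 * y) := by
        gcongr
      rw [← mul_assoc, h4, one_mul] at h5
      calc y ^ (p - α) * L y ≤ y ^ (p - α) * ((2:ℝ) ^ (p - α) * L (2 * y)) := by gcongr
        _ = _ := by ring
    set c := min (y0 ^ (p - 2)) ((2 * x0) ^ (p - 2)) * (y0 ^ (2 - α) * L y0) with hc
    have hL0 := hLpos y0 hy0
    have hbase : ∀ y, y0 ≤ y → y ≤ 2 * x0 → c ≤ y ^ (p - α) * L y := by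
      intro y h3 h4
      have hyp : 0 < y := hy0.trans_le h3
      have h5 : y ^ (p - α) = y ^ (p - 2) * y ^ (2 - α) := by
        rw [← Real.rpow_add hyp]; congr 1; ring
      rw [h5, mul_assoc, hc]
      apply mul_le_mul _ (hmono y0 y hy0 h3) (by positivity) (by positivity)
      rcases le_total 0 (p - 2) with h6 | h6
      · exact (min_le_left _ _).trans (Real.rpow_le_rpow hy0.le h3 h6)
      · exact (min_le_right _ _).trans (Real.rpow_le_rpow_of_nonpos hyp h4 h6)
    have hind : ∀ n : ℕ, ∀ y, y0 ≤ y → y ≤ 2 ^ (n + 1) * x0 → c ≤ y ^ (p - α) * L y := by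
      intro n
      induction n with
      | zero => intro y h3 h4; exact hbase y h3 (by simpa using h4)
      | succ n ih =>
        intro y h3 h4
        by_cases h5 : y ≤ 2 * x0
        · exact hbase y h3 h5
        · push Not at h5
          have h6 : x0 ≤ y / 2 := by linarith
          have h7 := hdouble _ h6
          rw [show 2 * (y / 2) = y by ring] at h7
          refine (ih (y / 2) ((le_max_right _ _).trans h6) ?_).trans h7
          rw [pow_succ] at h4
          linarith
    refine ⟨c, by positivity, fun y hy => ?_⟩
    obtain ⟨n, hn⟩ := pow_unbounded_of_one_lt (y / x0) (one_lt_two : (1:ℝ) < 2)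
    apply hind n y hy
    rw [div_lt_iff₀ hx0p] at hn
    rw [pow_succ]
    have : 0 < (2:ℝ) ^ n * x0 := by positivity
    nlinarith

lemma wgt_low (L : ℝ → ℝ) (α p bL : ℝ) (hα : 0 < α) (hsv : SlowlyVarying L) (hLpos : ∀ x : ℝ, 0 < x → 0 < L x)
    (hbL : 1 ≤ bL)
    (hconst : ∀ x : ℝ, 0 < x → x ≤ bL → L x = L bL)
    (hlow : α = 2 → ∀ x : ℝ, 0 < x → 1 ≤ L x) (hα2 : α ≤ 2)
    (hmono : ∀ x y : ℝ, 0 < x → x ≤ y → x ^ (2 - α) * L x ≤ y ^ (2 - α) * L y)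
    (hp : (α < 2 → α < p) ∧ (α = 2 → p = 2)) (hp1 : 1 < p) :
    ∃ c : ℝ, 0 < c ∧ ∀ x, wgt L α x ≤ 1 → |x| ^ p ≤ c * wgt L α x := by
  have hb0 : 0 < bL := by linarith
  have hLb := hLpos bL hb0
  obtain ⟨c, hc, h⟩ := g_low L α p (min bL ((L bL) ^ (1 / α))) hsv hLpos hlow hα2 hmono hp (by positivity)
  refine ⟨c⁻¹, by positivity, fun x hx => ?_⟩
  by_cases hx0 : x = 0
  · subst hx0
    simp [wgt, Real.zero_rpow (by linarith : p ≠ 0)]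
  · unfold wgt at hx ⊢
    rw [if_neg hx0] at hx ⊢
    have hxp : 0 < |x| := abs_pos.mpr hx0
    have hy : min bL ((L bL) ^ (1 / α)) ≤ 1 / |x| := by
      by_cases hyb : 1 / |x| ≤ bL
      · refine (min_le_right _ _).trans ?_
        rw [hconst _ (by positivity) hyb] at hx
        have h1 : L bL ≤ (1 / |x|) ^ α := by
          rw [Real.div_rpow zero_le_one hxp.le, Real.one_rpow, le_div_iff₀ (by positivity)]
          linarith
        calc (L bL) ^ (1 / α) ≤ ((1 / |x|) ^ α) ^ (1 / α) := by gcongr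
          _ = 1 / |x| := by
            rw [← Real.rpow_mul (by positivity), mul_one_div_cancel hα.ne', Real.rpow_one]
      · exact (min_le_left _ _).trans (not_le.mp hyb).le
    have h1 := h _ hy
    have h2 : |x| ^ α = |x| ^ p * (1 / |x|) ^ (p - α) := by
      rw [one_div, Real.inv_rpow hxp.le, ← Real.rpow_neg hxp.le, ← Real.rpow_add hxp]
      congr 1; ring
    rw [h2, le_inv_mul_iff₀ hc, mul_assoc, mul_comm c]
    gcongr

lemma choose_K {d : ℕ} (p δ A M x : ℝ) (hp : 1 < p) (hδ : 0 < δ) (hA : 0 ≤ A) (hM : 0 ≤ M)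
    (h : ∀ K : ℕ, 0 < K → x ≤ (K:ℝ) ^ d * (2 ^ d * (δ * A)) + 2 ^ d * ((K:ℝ) ^ (-(1 / p)) * M)) :
    x ≤ (2 ^ d * A + M + 1) * (2 ^ d * δ ^ (1 / ((d:ℝ) * p + 1)) + 2 ^ (2 * d) * δ) := by
  have hp0 : 0 < p := by linarith
  have hdp : 0 < (d:ℝ) * p + 1 := by positivity
  set r := δ ^ (-(p / ((d:ℝ) * p + 1))) with hr
  have hrp : 0 < r := by positivity
  set K := ⌈r⌉₊ with hK
  have hK0 : 0 < K := Nat.ceil_pos.mpr hrp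
  have hrK : r ≤ K := Nat.le_ceil r
  have hK1 : (K:ℝ) ≤ r + 1 := (Nat.ceil_lt_add_one hrp.le).le
  set D := δ ^ (1 / ((d:ℝ) * p + 1)) with hD
  have hDp : 0 < D := by positivity
  have e1 : r ^ (-(1 / p)) = D := by
    rw [hr, hD, ← Real.rpow_mul hδ.le]
    congr 1
    field_simp
  have e2 : r ^ d * δ = D := by
    rw [hr, hD, ← Real.rpow_natCast, ← Real.rpow_mul hδ.le]
    nth_rewrite 2 [← Real.rpow_one δ]
    rw [← Real.rpow_add hδ]
    congr 1
    field_simp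
    ring
  have e3 : (K:ℝ) ^ (-(1 / p)) ≤ D := by
    rw [← e1]
    exact Real.rpow_le_rpow_of_nonpos hrp hrK (by simp [hp0.le])
  have e4 : (K:ℝ) ^ d ≤ 2 ^ d * (r ^ d + 1) := by
    have h1 : (K:ℝ) ≤ 2 * max r 1 := by
      have := le_max_left r 1
      have := le_max_right r 1
      linarith
    calc (K:ℝ) ^ d ≤ (2 * max r 1) ^ d := by gcongr
      _ = 2 ^ d * (max r 1) ^ d := mul_pow _ _ _
      _ ≤ 2 ^ d * (r ^ d + 1) := by
        gcongr
        rcases le_total r 1 with h | h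
        · rw [max_eq_right h]; simp; positivity
        · rw [max_eq_left h]; linarith
  have e5 : (K:ℝ) ^ d * δ ≤ 2 ^ d * (D + δ) := by
    calc (K:ℝ) ^ d * δ ≤ 2 ^ d * (r ^ d + 1) * δ := by gcongr
      _ = 2 ^ d * (r ^ d * δ + δ) := by ring
      _ = _ := by rw [e2]
  have e6 : (1:ℝ) ≤ 2 ^ d := one_le_pow₀ (by norm_num)
  calc x ≤ _ := h K hK0
    _ = 2 ^ d * A * ((K:ℝ) ^ d * δ) + 2 ^ d * ((K:ℝ) ^ (-(1 / p)) * M) := by ring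
    _ ≤ 2 ^ d * A * (2 ^ d * (D + δ)) + 2 ^ d * (D * M) := by gcongr
    _ = (2 ^ d * A) * (2 ^ d * D + 2 ^ d * δ) + M * (2 ^ d * D) := by ring
    _ ≤ (2 ^ d * A) * (2 ^ d * D + 2 ^ (2 * d) * δ) + (M + 1) * (2 ^ d * D + 2 ^ (2 * d) * δ) := by
      have : (2:ℝ) ^ d ≤ 2 ^ (2 * d) := pow_le_pow_right₀ (by norm_num) (by omega)
      gcongr
      · linarith
      · have : 0 ≤ (2:ℝ) ^ (2 * d) * δ := by positivity
        linarith
    _ = _ := by ring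

/-- Lemma `lemmarho`, inequality (rho2):
`ρ_n ≪ 2^d (J_n^{1/q}/B_n)^{1/(dp+1)} + 2^{2d} J_n^{1/q}/B_n`, so `J_n = o(B_n^q)`
implies `ρ_n → 0`. -/
theorem stmt13
    {d : ℕ} (hd : 0 < d)
    (α : ℝ) (hα : 0 < α) (hα2 : α ≤ 2)
    -- `L` is the truncated second-moment function of an innovation in the domain of
    -- attraction of an α-stable law, with the properties used in the proof:
    (L : ℝ → ℝ) (hsv : SlowlyVarying L) (hLpos : ∀ x : ℝ, 0 < x → 0 < L x)
    (bL : ℝ) (hbL : 1 ≤ bL)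
    (hconst : ∀ x : ℝ, 0 < x → x ≤ bL → L x = L bL)
    (hlow : (α < 2 → ∀ x : ℝ, 0 < x → (max bL x) ^ (α - 2) * (2 - α) / α ≤ L x) ∧
      (α = 2 → ∀ x : ℝ, 0 < x → 1 ≤ L x))
    (hmono : ∀ x y : ℝ, 0 < x → x ≤ y → x ^ (2 - α) * L x ≤ y ^ (2 - α) * L y)
    (p q : ℝ)
    (hp : (α < 2 → max 1 α < p) ∧ (α = 2 → p = 2))
    (hq : 1 / p + 1 / q = 1)
    (a : (Fin d → ℤ) → ℝ)
    (hap : Summable (fun i => |a i| ^ p))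
    (J : ℕ → ℕ) (Γ : ℕ → Finset (Fin d → ℤ)) (hΓ : ∀ n, IsRectUnion (Γ n) (J n))
    (b : ℕ → (Fin d → ℤ) → ℝ) (hb : ∀ n i, b n i = ∑ j ∈ Γ n, a (j - i))
    (B : ℕ → ℝ) (hB1 : ∀ n, 1 ≤ B n)
    -- the normalization `Σ_i (|b_{ni}|/B_n)^α L(B_n/|b_{ni}|) = 1`
    (hsum : ∀ n, Summable (fun i => wgt L α (b n i / B n)))
    (hnorm : ∀ n, ∑' i, wgt L α (b n i / B n) = 1) :
    (∃ C : ℝ, 0 < C ∧ ∀ n i,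
      |b n i| / B n ≤ C * (2 ^ d * ((J n : ℝ) ^ (1 / q) / B n) ^ (1 / ((d : ℝ) * p + 1)) +
        2 ^ (2 * d) * (J n : ℝ) ^ (1 / q) / B n)) ∧
    (Tendsto (fun n => (J n : ℝ) / B n ^ q) atTop (nhds 0) →
      ∀ ε : ℝ, 0 < ε → ∃ N : ℕ, ∀ n ≥ N, ∀ i, |b n i| ≤ ε * B n) := by
  classical
  have hp1 : 1 < p := by
    rcases hα2.eq_or_lt with h2 | h2
    · rw [hp.2 h2]; norm_num
    · exact (le_max_left _ _).trans_lt (hp.1 h2)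
  have hp0 : 0 < p := by linarith
  have hq0 : 0 < q := by
    have h1 : 1 / p < 1 := by rw [div_lt_one hp0]; exact hp1
    have h2 : 0 < 1 / q := by linarith
    exact one_div_pos.mp h2
  obtain ⟨c, hc, hwl⟩ := wgt_low L α p bL hα hsv hLpos hbL hconst hlow.2 hα2 hmono
    ⟨fun h => (le_max_right _ _).trans_lt (hp.1 h), hp.2⟩ hp1
  have hB0 : ∀ n, 0 < B n := fun n => one_pos.trans_le (hB1 n)
  have hwnn : ∀ x, 0 ≤ wgt L α x := by
    intro x
    unfold wgt
    split_ifs with hx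
    · exact le_rfl
    · have : 0 < |x| := abs_pos.mpr hx
      have := hLpos (1 / |x|) (by positivity)
      positivity
  have hM : ∀ n (s : Finset (Fin d → ℤ)), ∑ i ∈ s, |b n i / B n| ^ p ≤ c := by
    intro n s
    have h1 : ∀ i, wgt L α (b n i / B n) ≤ 1 := by
      intro i
      rw [← hnorm n]
      exact (hsum n).le_tsum i (fun _ _ => hwnn _)
    calc _ ≤ ∑ i ∈ s, c * wgt L α (b n i / B n) := Finset.sum_le_sum fun i _ => hwl _ (h1 i)
      _ = c * ∑ i ∈ s, wgt L α (b n i / B n) := by rw [Finset.mul_sum]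
      _ ≤ c * 1 := by
        gcongr
        rw [← hnorm n]
        exact (hsum n).sum_le_tsum s (fun _ _ => hwnn _)
      _ = c := mul_one c
  have hJ : ∀ n, 0 < J n := by
    intro n
    rcases Nat.eq_zero_or_pos (J n) with h | h
    · exfalso
      obtain ⟨R, _, _, hR⟩ := hΓ n
      have hE : Γ n = ∅ := by
        rw [hR, Finset.eq_empty_iff_forall_notMem]
        intro x hx
        obtain ⟨k, _, _⟩ := Finset.mem_biUnion.mp hx
        have := k.2
        omega
      have h0 := hnorm n
      simp [hb, hE, wgt] at h0
    · exact h
  set A : ℝ := (∑' i, |a i| ^ p) ^ (1 / p) with hA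
  have hA0 : 0 ≤ A := Real.rpow_nonneg (tsum_nonneg fun i => Real.rpow_nonneg (abs_nonneg _) _) _
  have hδ0 : ∀ n, 0 < (J n : ℝ) ^ (1 / q) / B n := by
    intro n
    have : (0:ℝ) < J n := by exact_mod_cast hJ n
    have := hB0 n
    positivity
  have hmain : ∀ n i, |b n i| / B n ≤ (2 ^ d * A + c ^ (1 / p) + 1) *
      (2 ^ d * ((J n : ℝ) ^ (1 / q) / B n) ^ (1 / ((d : ℝ) * p + 1)) +
        2 ^ (2 * d) * ((J n : ℝ) ^ (1 / q) / B n)) := by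
    intro n i
    apply choose_K p _ A _ _ hp1 (hδ0 n) hA0 (by positivity)
    intro K hK
    have h1 := avg_bound (fun i => b n i / B n) p q c (2 ^ d * ((J n : ℝ) ^ (1 / q) / B n * A))
      hp1 hq (hM n) (by have := hδ0 n; positivity) (by
        intro i t
        have h2 := mixed_bound a p q hp1 hq hap (Γ n) (J n) (hΓ n) i t
        have h3 : ∑ e : Fin d → Bool, sg e * (b n (i + sh t e) / B n) =
            (∑ e : Fin d → Bool, sg e * ∑ j ∈ Γ n, a (j - (i + sh t e))) / B n := by
          rw [Finset.sum_div]
          apply Finset.sum_congr rfl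
          intro e _
          rw [hb]
          ring
        rw [h3, abs_div, abs_of_pos (hB0 n), div_le_iff₀ (hB0 n)]
        refine h2.trans (le_of_eq ?_)
        have := (hB0 n).ne'
        rw [mul_pow, ← hA]
        field_simp) K hK i
    simpa only [abs_div, abs_of_pos (hB0 n)] using h1
  refine ⟨⟨2 ^ d * A + c ^ (1 / p) + 1, by positivity, ?_⟩, ?_⟩
  · intro n i
    have := hmain n i
    rwa [← mul_div_assoc] at this
  · intro hT ε hε
    have hT1 : Tendsto (fun n => (J n : ℝ) ^ (1 / q) / B n) atTop (nhds 0) := by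
      have h1 := hT.rpow_const (p := 1 / q) (Or.inr (by positivity))
      rw [Real.zero_rpow (by positivity)] at h1
      refine h1.congr fun n => ?_
      rw [Real.div_rpow (by positivity) (Real.rpow_nonneg (hB0 n).le _), ← Real.rpow_mul (hB0 n).le,
        mul_one_div_cancel hq0.ne', Real.rpow_one]
    have hT2 := hT1.rpow_const (p := 1 / ((d : ℝ) * p + 1)) (Or.inr (by positivity))
    rw [Real.zero_rpow (by positivity)] at hT2
    have hT3 := ((hT2.const_mul (2 ^ d)).add (hT1.const_mul (2 ^ (2 * d)))).const_mul
      (2 ^ d * A + c ^ (1 / p) + 1)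
    simp only [mul_zero, add_zero] at hT3
    obtain ⟨N, hN⟩ := eventually_atTop.mp (hT3.eventually (gt_mem_nhds hε))
    refine ⟨N, fun n hn i => ?_⟩
    have := (hmain n i).trans (hN n hn).le
    rwa [div_le_iff₀ (hB0 n)] at this

end
end

section
/- Let d = 2, α ∈ (1,2], and β_1, β_2 ∈ (0,1) with (1 − β_k)α > 1 for k = 1, 2. Define the spatial fractional ARIMA coefficients a_{j_1,j_2} = Γ(j_1+β_1)Γ(j_2+β_2)/(Γ(β_1)Γ(β_2) j_1! j_2!) for j_1, j_2 ≥ 0 (and 0 otherwise). Take Γ_n² = [0,n]² ∩ ℤ² and b_{ni} = Σ_{(j_1,j_2)∈Γ_n²} a_{j_1−i_1, j_2−i_2}. Then B_n = (Σ_{i∈ℤ²} |b_{ni}|^α)^{1/α} satisfies B_n ~ C_0 · n^{β_1+β_2+2/α} as n → ∞, where C_0 = (C/(β_1β_2)) ( ∫_{−∞}^1 [(1−x)^{β_1} − (−x)_+^{β_1}]^α dx · ∫_{−∞}^1 [(1−x)^{β_2} − (−x)_+^{β_2}]^α dx )^{1/α} for an appropriate positive constant C, and x_+ = max{x, 0}.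 -/
open Filter Topology MeasureTheory

noncomputable section

/-- one-dimensional coefficients -/
def wc (β : ℝ) (m : ℤ) : ℝ :=
  if 0 ≤ m then Real.Gamma ((m : ℝ) + β) / (Real.Gamma β * (m.toNat.factorial : ℝ)) else 0

/-- partial sums of the one-dimensional coefficients -/
def Ac (β : ℝ) (m : ℤ) : ℝ :=
  if 0 ≤ m then Real.Gamma ((m : ℝ) + 1 + β) / (β * Real.Gamma β * (m.toNat.factorial : ℝ)) else 0

/-- one-dimensional windows -/
def cc (β : ℝ) (n : ℕ) (i : ℤ) : ℝ := ∑ j ∈ Finset.Icc (0:ℤ) (n:ℤ), wc β (j - i)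

lemma wc_nonneg {β : ℝ} (hβ : 0 < β) (m : ℤ) : 0 ≤ wc β m := by
  unfold wc
  split_ifs with h
  · have : (0:ℝ) ≤ m := by exact_mod_cast h
    have := Real.Gamma_pos_of_pos (show (0:ℝ) < m + β by linarith)
    have := Real.Gamma_pos_of_pos hβ
    positivity
  · exact le_rfl

lemma Ac_nonneg {β : ℝ} (hβ : 0 < β) (m : ℤ) : 0 ≤ Ac β m := by
  unfold Ac
  split_ifs with h
  · have : (0:ℝ) ≤ m := by exact_mod_cast h
    have := Real.Gamma_pos_of_pos (show (0:ℝ) < m + 1 + β by linarith)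
    have := Real.Gamma_pos_of_pos hβ
    positivity
  · exact le_rfl

lemma Ac_of_neg {β : ℝ} {m : ℤ} (h : m < 0) : Ac β m = 0 := by
  unfold Ac
  rw [if_neg (by omega)]

lemma Ac_eq_wc {β : ℝ} (hβ : 0 < β) (m : ℤ) (hm : 0 ≤ m) :
    β * Ac β m = ((m:ℝ) + β) * wc β m := by
  unfold Ac wc
  rw [if_pos hm, if_pos hm]
  have h0 : (0:ℝ) ≤ m := by exact_mod_cast hm
  have hG := Real.Gamma_pos_of_pos hβ
  rw [show (m:ℝ) + 1 + β = (m + β) + 1 by ring, Real.Gamma_add_one (by linarith)]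
  have hf : (0:ℝ) < (m.toNat.factorial : ℝ) := by positivity
  field_simp

lemma wc_eq {β : ℝ} (hβ : 0 < β) (m : ℤ) : wc β m = Ac β m - Ac β (m - 1) := by
  have hG := Real.Gamma_pos_of_pos hβ
  rcases lt_trichotomy m 0 with h | h | h
  · rw [Ac_of_neg h, Ac_of_neg (by omega)]
    unfold wc
    rw [if_neg (by omega)]; simp
  · subst h
    rw [Ac_of_neg (show (0:ℤ) - 1 < 0 by norm_num)]
    unfold wc Ac
    simp
    rw [add_comm, Real.Gamma_add_one hβ.ne', div_self hG.ne', div_self (by positivity)]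
  · obtain ⟨k, rfl⟩ : ∃ k : ℕ, m = k + 1 := ⟨(m - 1).toNat, by omega⟩
    unfold wc Ac
    rw [if_pos (by omega), if_pos (by omega), if_pos (by omega)]
    have e1 : ((k:ℤ) + 1).toNat = k + 1 := by omega
    have e2 : ((k:ℤ) + 1 - 1).toNat = k := by omega
    rw [e1, e2, Nat.factorial_succ]
    push_cast
    rw [show (k:ℝ) + 1 + 1 + β = (k + 1 + β) + 1 by ring,
      Real.Gamma_add_one (show (k:ℝ) + 1 + β ≠ 0 by positivity)]
    rw [show (k:ℝ) + 1 - 1 + 1 + β = k + 1 + β by ring]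
    have hf : (0:ℝ) < (k.factorial : ℝ) := by positivity
    field_simp
    ring

lemma cc_eq {β : ℝ} (hβ : 0 < β) (n : ℕ) (i : ℤ) :
    cc β n i = Ac β (n - i) - Ac β (-1 - i) := by
  unfold cc
  induction n with
  | zero => simp [wc_eq hβ]; congr 1; ring
  | succ n ih =>
    have : Finset.Icc (0:ℤ) ((n+1:ℕ):ℤ) = insert ((n:ℤ)+1) (Finset.Icc (0:ℤ) n) := by
      ext x; simp; omega
    rw [this, Finset.sum_insert (by simp), ih, wc_eq hβ]
    push_cast
    rw [show (n:ℤ) + 1 - i - 1 = n - i by ring]; ring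

lemma cc_nonneg {β : ℝ} (hβ : 0 < β) (n : ℕ) (i : ℤ) : 0 ≤ cc β n i :=
  Finset.sum_nonneg fun _ _ => wc_nonneg hβ _

lemma Gamma_prod {β : ℝ} (hβ : 0 < β) (m : ℕ) :
    Real.Gamma (m + β) = Real.Gamma β * ∏ j ∈ Finset.range m, (β + j) := by
  induction m with
  | zero => simp
  | succ m ih =>
    rw [Finset.prod_range_succ, ← mul_assoc, ← ih]
    push_cast
    rw [show (m:ℝ) + 1 + β = (m + β) + 1 by ring, Real.Gamma_add_one (by positivity)]
    ring

lemma Ac_tendsto {β : ℝ} (hβ : 0 < β) :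
    Tendsto (fun m : ℕ => Ac β m / (m:ℝ) ^ β) atTop (𝓝 (1 / (β * Real.Gamma β))) := by
  have hG := Real.Gamma_pos_of_pos hβ
  have h := (Real.GammaSeq_tendsto_Gamma β).inv₀ hG.ne'
  have h := h.const_mul (1/β)
  rw [show 1 / β * (Real.Gamma β)⁻¹ = 1 / (β * Real.Gamma β) by field_simp] at h
  refine h.congr' ?_
  filter_upwards [eventually_gt_atTop 0] with m hm
  have hm' : (0:ℝ) < m := by exact_mod_cast hm
  have := Gamma_prod hβ (m+1)
  push_cast at this
  unfold Ac Real.GammaSeq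
  simp only [Nat.cast_nonneg, if_true, Int.toNat_natCast, Int.cast_natCast]
  rw [this]
  have hf : (0:ℝ) < (m.factorial : ℝ) := by positivity
  have hp : (0:ℝ) < ∏ j ∈ Finset.range (m+1), (β + j) :=
    Finset.prod_pos fun j _ => by positivity
  have hr : (0:ℝ) < (m:ℝ)^β := by positivity
  field_simp

lemma Ac_bound {β : ℝ} (hβ : 0 < β) :
    ∃ K : ℝ, 0 < K ∧ ∀ m : ℤ, Ac β m ≤ K * (max (m:ℝ) 1) ^ β := by
  obtain ⟨M, hM⟩ := (Ac_tendsto hβ).bddAbove_range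
  refine ⟨max M (max (Ac β 0) 1), by positivity, fun m => ?_⟩
  have hK : 0 < max M (max (Ac β 0) 1) := by positivity
  rcases lt_trichotomy m 0 with h | h | h
  · rw [Ac_of_neg h]; positivity
  · subst h; simp
  · obtain ⟨k, rfl⟩ : ∃ k : ℕ, m = k := ⟨m.toNat, by omega⟩
    have hk : (1:ℝ) ≤ k := by exact_mod_cast h
    have := hM ⟨k, rfl⟩
    simp only at this
    have hr : (0:ℝ) < (k:ℝ)^β := by positivity
    rw [div_le_iff₀ hr] at this
    rw [Int.cast_natCast, max_eq_left hk]
    refine this.trans ?_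
    gcongr
    exact le_max_left _ _

lemma wc_bound {β K : ℝ} (hβ : 0 < β) (hβ' : β < 1)
    (hK : 0 < K) (h : ∀ m : ℤ, Ac β m ≤ K * (max (m:ℝ) 1) ^ β) (m : ℤ) (hm : 1 ≤ m) :
    wc β m ≤ K * (m:ℝ) ^ (β - 1) := by
  have h1 : (1:ℝ) ≤ m := by exact_mod_cast hm
  have e := Ac_eq_wc hβ m (by omega)
  have h2 := h m
  rw [max_eq_left h1] at h2
  have hw := wc_nonneg hβ m
  have hA := Ac_nonneg hβ m
  have : (m:ℝ) * wc β m ≤ K * (m:ℝ)^β := by nlinarith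
  rw [Real.rpow_sub_one (by positivity)]
  rw [mul_div_assoc', le_div_iff₀ (by positivity)]
  linarith

lemma floor_tendsto (x : ℝ) :
    Tendsto (fun n : ℕ => ((⌊(n:ℝ) * x⌋ : ℤ) : ℝ) / n) atTop (𝓝 x) := by
  have h0 : Tendsto (fun n : ℕ => x - 1/(n:ℝ)) atTop (𝓝 (x - 0)) :=
    tendsto_const_nhds.sub tendsto_one_div_atTop_nhds_zero_nat
  rw [sub_zero] at h0
  refine tendsto_of_tendsto_of_tendsto_of_le_of_le' h0 tendsto_const_nhds ?_ ?_
  · filter_upwards [eventually_gt_atTop 0] with n hn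
    have hn' : (0:ℝ) < n := by exact_mod_cast hn
    have := Int.sub_one_lt_floor ((n:ℝ) * x)
    rw [le_div_iff₀ hn', sub_mul, one_div_mul_cancel hn'.ne']
    linarith
  · filter_upwards [eventually_gt_atTop 0] with n hn
    have hn' : (0:ℝ) < n := by exact_mod_cast hn
    have := Int.floor_le ((n:ℝ) * x)
    rw [div_le_iff₀ hn']
    linarith

lemma Ac_scaled {β : ℝ} (hβ : 0 < β) (m : ℕ → ℤ) (t : ℝ) (ht : t ≠ 0)
    (hm : Tendsto (fun n : ℕ => (m n : ℝ) / n) atTop (𝓝 t)) :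
    Tendsto (fun n : ℕ => Ac β (m n) / (n:ℝ) ^ β) atTop
      (𝓝 (1 / (β * Real.Gamma β) * (max t 0) ^ β)) := by
  rcases lt_or_gt_of_ne ht with h | h
  · rw [max_eq_right h.le, Real.zero_rpow hβ.ne', mul_zero]
    refine tendsto_const_nhds.congr' ?_
    filter_upwards [hm.eventually_lt_const h] with n hn
    have : m n < 0 := by
      by_contra hc
      push Not at hc
      have : (0:ℝ) ≤ m n := by exact_mod_cast hc
      have : (0:ℝ) ≤ (m n : ℝ) / n := by positivity
      linarith
    rw [Ac_of_neg this, zero_div]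
  · rw [max_eq_left h.le]
    have hinf : Tendsto (fun n => (m n : ℝ)) atTop atTop := by
      have := hm.pos_mul_atTop h (tendsto_natCast_atTop_atTop (R := ℝ))
      refine this.congr' ?_
      filter_upwards [eventually_gt_atTop 0] with n hn
      have hn' : (0:ℝ) < n := by exact_mod_cast hn
      field_simp
    have hinf2 : Tendsto m atTop atTop := tendsto_intCast_atTop_iff.1 hinf
    have hinf3 : Tendsto (fun n => (m n).toNat) atTop atTop := by
      rw [tendsto_atTop] at hinf2 ⊢
      intro b
      filter_upwards [hinf2 b] with n hn
      omega
    have h1 := (Ac_tendsto hβ).comp hinf3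
    have h2 := hm.rpow_const (p := β) (Or.inr hβ.le)
    refine (h1.mul h2).congr' ?_
    filter_upwards [eventually_gt_atTop 0, hinf2.eventually_gt_atTop 0] with n hn hmn
    have hn' : (0:ℝ) < n := by exact_mod_cast hn
    have hmn' : (0:ℝ) < m n := by exact_mod_cast hmn
    have e : (((m n).toNat : ℕ) : ℤ) = m n := by omega
    have e' : (((m n).toNat : ℕ) : ℝ) = m n := by exact_mod_cast congrArg (Int.cast (R := ℝ)) e
    simp only [Function.comp, e, e']
    rw [Real.div_rpow hmn'.le hn'.le]
    have : 0 < (m n : ℝ)^β := by positivity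
    field_simp

lemma cc_scaled {β : ℝ} (hβ : 0 < β) (x : ℝ) (h0 : x ≠ 0) (h1 : x ≠ 1) :
    Tendsto (fun n : ℕ => cc β n ⌊(n:ℝ) * x⌋ / (n:ℝ) ^ β) atTop
      (𝓝 (1 / (β * Real.Gamma β) * ((max (1 - x) 0) ^ β - (max (-x) 0) ^ β))) := by
  have f := floor_tendsto x
  have z := tendsto_one_div_atTop_nhds_zero_nat (𝕜 := ℝ)
  have a1 := Ac_scaled hβ (fun n : ℕ => (n:ℤ) - ⌊(n:ℝ) * x⌋) (1 - x) (sub_ne_zero.2 h1.symm) (by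
    refine ((tendsto_const_nhds (x := (1:ℝ))).sub f).congr' ?_
    filter_upwards [eventually_gt_atTop 0] with n hn
    have hn' : (0:ℝ) < n := by exact_mod_cast hn
    push_cast
    field_simp)
  have a2 := Ac_scaled hβ (fun n : ℕ => -1 - ⌊(n:ℝ) * x⌋) (-x) (neg_ne_zero.2 h0) (by
    have := z.neg.sub f
    rw [neg_zero, zero_sub] at this
    refine this.congr' ?_
    filter_upwards [eventually_gt_atTop 0] with n hn
    have hn' : (0:ℝ) < n := by exact_mod_cast hn
    push_cast
    field_simp)
  rw [mul_sub]
  refine (a1.sub a2).congr fun n => ?_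
  rw [cc_eq hβ, sub_div]

lemma cc_bound {β : ℝ} (hβ : 0 < β) (hβ' : β < 1) :
    ∃ D : ℝ, 0 < D ∧ ∀ (n : ℕ) (x : ℝ), 0 < n →
      cc β n ⌊(n:ℝ) * x⌋ / (n:ℝ) ^ β ≤ D * (1 + |x|) ^ (β - 1) := by
  obtain ⟨K, hK, hA⟩ := Ac_bound hβ
  refine ⟨6 * K, by positivity, fun n x hn => ?_⟩
  have hn' : (1:ℝ) ≤ n := by exact_mod_cast hn
  have hnr : (0:ℝ) < (n:ℝ)^β := by positivity
  have hfl := Int.floor_le ((n:ℝ) * x)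
  rw [div_le_iff₀ hnr]
  by_cases c1 : 2 < x
  · have : (n:ℤ) < ⌊(n:ℝ) * x⌋ := by
      rw [Int.lt_iff_add_one_le, Int.le_floor]; push_cast; nlinarith
    rw [cc_eq hβ, Ac_of_neg (by omega), Ac_of_neg (by omega)]
    simp; positivity
  push Not at c1
  by_cases c2 : -1 ≤ x
  · have hf : -(n:ℤ) ≤ ⌊(n:ℝ) * x⌋ := by
      rw [Int.le_floor]; push_cast; nlinarith
    have h1 : cc β n ⌊(n:ℝ) * x⌋ ≤ K * (2 * n : ℝ) ^ β := by
      rw [cc_eq hβ]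
      have := Ac_nonneg hβ (-1 - ⌊(n:ℝ) * x⌋)
      have h2 := hA (n - ⌊(n:ℝ) * x⌋)
      have h3 : max (((n - ⌊(n:ℝ) * x⌋ : ℤ)) : ℝ) 1 ≤ 2 * n := by
        refine max_le ?_ (by linarith)
        have : (n - ⌊(n:ℝ) * x⌋ : ℤ) ≤ 2 * n := by omega
        exact_mod_cast this
      have h4 : (max (((n - ⌊(n:ℝ) * x⌋ : ℤ)) : ℝ) 1) ^ β ≤ (2 * n : ℝ)^β :=
        Real.rpow_le_rpow (by positivity) h3 hβ.le
      nlinarith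
    have h5 : (2:ℝ)^β ≤ 2 := by
      simpa using Real.rpow_le_rpow_of_exponent_le (show (1:ℝ) ≤ 2 by norm_num) hβ'.le
    have h6 : (1:ℝ)/3 ≤ (1 + |x|) ^ (β - 1) := by
      have hx : |x| ≤ 2 := abs_le.2 ⟨by linarith, c1⟩
      calc (1:ℝ)/3 = (3:ℝ)^(-1:ℝ) := by rw [Real.rpow_neg_one]; norm_num
        _ ≤ (1+|x|)^(-1:ℝ) :=
          Real.rpow_le_rpow_of_nonpos (by positivity) (by linarith) (by norm_num)
        _ ≤ _ := Real.rpow_le_rpow_of_exponent_le (by linarith [abs_nonneg x]) (by linarith)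
    rw [Real.mul_rpow (by norm_num) (by linarith)] at h1
    calc _ ≤ K * (2 ^ β * (n:ℝ)^β) := h1
      _ ≤ K * (2 * (n:ℝ)^β) := by gcongr
      _ = 6 * K * (1/3) * (n:ℝ)^β := by ring
      _ ≤ _ := by gcongr
  · push Not at c2
    have hx : |x| = -x := abs_of_neg (by linarith)
    have hnx : (0:ℝ) < n * (-x) := by nlinarith
    have h1 : cc β n ⌊(n:ℝ) * x⌋ ≤ (n+1) * (K * (n * (-x)) ^ (β - 1)) := by
      unfold cc
      have : ∀ j ∈ Finset.Icc (0:ℤ) (n:ℤ), wc β (j - ⌊(n:ℝ) * x⌋) ≤ K * (n * (-x)) ^ (β - 1) := by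
        intro j hj
        rw [Finset.mem_Icc] at hj
        have hj0 : (0:ℝ) ≤ j := by exact_mod_cast hj.1
        have hge : (n:ℝ) * (-x) ≤ ((j - ⌊(n:ℝ) * x⌋ : ℤ) : ℝ) := by push_cast; linarith
        have hpos : 1 ≤ j - ⌊(n:ℝ) * x⌋ := by
          have : (0:ℝ) < ((j - ⌊(n:ℝ) * x⌋ : ℤ) : ℝ) := by linarith
          have : 0 < j - ⌊(n:ℝ) * x⌋ := by exact_mod_cast this
          omega
        refine (wc_bound hβ hβ' hK hA _ hpos).trans ?_
        exact mul_le_mul_of_nonneg_left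
          (Real.rpow_le_rpow_of_nonpos hnx hge (by linarith)) hK.le
      refine (Finset.sum_le_card_nsmul _ _ _ this).trans ?_
      simp
    have h2 : (-x) ^ (β - 1) ≤ 2 * (1 + |x|) ^ (β - 1) := by
      rw [hx]
      calc (-x) ^ (β - 1) ≤ ((1 + -x) * (1/2)) ^ (β - 1) :=
            Real.rpow_le_rpow_of_nonpos (by linarith) (by linarith) (by linarith)
        _ = (1 + -x)^(β-1) * (1/2)^(β-1) := Real.mul_rpow (by linarith) (by norm_num)
        _ ≤ (1 + -x)^(β-1) * 2 := by
          have h0 : (0:ℝ) < 1 + -x := by linarith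
          have : (1/2:ℝ)^(β-1) ≤ (1/2:ℝ)^(-1:ℝ) :=
            Real.rpow_le_rpow_of_exponent_ge (by norm_num) (by norm_num) (by linarith)
          rw [Real.rpow_neg_one] at this
          norm_num at this ⊢
          gcongr
        _ = _ := by ring
    have h3 : (n:ℝ)^(β-1) * n = (n:ℝ)^β := by
      rw [Real.rpow_sub_one (by positivity)]; field_simp
    rw [Real.mul_rpow (by linarith) (by linarith)] at h1
    have hxp : 0 < (-x)^(β-1) := Real.rpow_pos_of_pos (by linarith) _
    have hnp : 0 < (n:ℝ)^(β-1) := by positivity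
    calc _ ≤ (n+1) * (K * ((n:ℝ)^(β-1) * (-x)^(β-1))) := h1
      _ ≤ (2*n) * (K * ((n:ℝ)^(β-1) * (-x)^(β-1))) := by gcongr; linarith
      _ = 2 * K * (n:ℝ)^β * (-x)^(β-1) := by rw [← h3]; ring
      _ ≤ 2 * K * (n:ℝ)^β * (2 * (1 + |x|) ^ (β - 1)) := by gcongr
      _ = 4 * K * (1 + |x|) ^ (β - 1) * (n:ℝ)^β := by ring
      _ ≤ _ := by gcongr; norm_num

/-- the limiting profile -/
def gl (β x : ℝ) : ℝ := (max (1 - x) 0) ^ β - (max (-x) 0) ^ β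

lemma gl_nonneg {β : ℝ} (hβ : 0 < β) (x : ℝ) : 0 ≤ gl β x :=
  sub_nonneg.2 (Real.rpow_le_rpow (by positivity) (max_le_max (by linarith) le_rfl) hβ.le)

lemma ae_ne01 : ∀ᵐ x : ℝ, x ≠ 0 ∧ x ≠ 1 := by
  filter_upwards [Measure.ae_ne volume (0:ℝ), Measure.ae_ne volume (1:ℝ)] with x h0 h1
  exact ⟨h0, h1⟩

lemma pow_scaled {α β : ℝ} (hα : 1 < α) (hβ : 0 < β) (x : ℝ) (h0 : x ≠ 0) (h1 : x ≠ 1) :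
    Tendsto (fun n : ℕ => (cc β n ⌊(n:ℝ) * x⌋ / (n:ℝ) ^ β) ^ α) atTop
      (𝓝 ((1 / (β * Real.Gamma β)) ^ α * gl β x ^ α)) := by
  have hG := Real.Gamma_pos_of_pos hβ
  rw [← Real.mul_rpow (by positivity) (gl_nonneg hβ x)]
  exact (cc_scaled hβ x h0 h1).rpow_const (Or.inr (by linarith))

lemma dom {α β : ℝ} (hα : 1 < α) (hβ : 0 < β) (hβ' : β < 1) (h : 1 < (1 - β) * α) :
    ∃ H : ℝ → ℝ, Integrable H ∧ ∀ (n : ℕ) (x : ℝ), 0 < n →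
      (cc β n ⌊(n:ℝ) * x⌋ / (n:ℝ) ^ β) ^ α ≤ H x := by
  obtain ⟨D, hD, hb⟩ := cc_bound hβ hβ'
  refine ⟨fun x => D ^ α * (1 + ‖x‖) ^ (-((1 - β) * α)), ?_, fun n x hn => ?_⟩
  · exact (integrable_one_add_norm (by simpa using h)).const_mul _
  · have h1 := Real.rpow_le_rpow (div_nonneg (cc_nonneg hβ _ _) (by positivity)) (hb n x hn)
      (show 0 ≤ α by linarith)
    refine h1.trans (le_of_eq ?_)
    simp only [Real.norm_eq_abs]
    rw [Real.mul_rpow hD.le (by positivity), ← Real.rpow_mul (by positivity)]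
    congr 2; ring

lemma meas {α β : ℝ} (n : ℕ) :
    Measurable (fun x : ℝ => (cc β n ⌊(n:ℝ) * x⌋ / (n:ℝ) ^ β) ^ α) := by
  have : Measurable (fun i : ℤ => (cc β n i / (n:ℝ) ^ β) ^ α) := measurable_from_top
  exact this.comp (Int.measurable_floor.comp (measurable_const_mul _))

lemma hn_integrable {α β : ℝ} (hα : 1 < α) (hβ : 0 < β) (hβ' : β < 1) (h : 1 < (1 - β) * α)
    (n : ℕ) (hn : 0 < n) :
    Integrable (fun x : ℝ => (cc β n ⌊(n:ℝ) * x⌋ / (n:ℝ) ^ β) ^ α) := by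
  obtain ⟨H, hH, hb⟩ := dom hα hβ hβ' h
  refine hH.mono' (meas n).aestronglyMeasurable (ae_of_all _ fun x => ?_)
  rw [Real.norm_of_nonneg (Real.rpow_nonneg (div_nonneg (cc_nonneg hβ _ _) (by positivity)) _)]
  exact hb n x hn

lemma hasSum_floor (f : ℤ → ℝ) (hf : Integrable (fun x : ℝ => f ⌊x⌋)) :
    HasSum f (∫ x : ℝ, f ⌊x⌋) := by
  have := hf.hasSum_intervalIntegral_comp_add_int
  have e : ∀ i : ℤ, ∫ x in (0:ℝ)..1, f ⌊x + (i:ℝ)⌋ = f i := by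
    intro i
    have e2 : ∫ x in (0:ℝ)..1, f i = f i := by simp
    refine Eq.trans ?_ e2
    refine intervalIntegral.integral_congr_ae ?_
    filter_upwards [Measure.ae_ne volume (1:ℝ)] with x hx1 hx
    rw [Set.uIoc_of_le zero_le_one] at hx
    have : ⌊x⌋ = 0 := Int.floor_eq_zero_iff.2 ⟨hx.1.le, lt_of_le_of_ne hx.2 hx1⟩
    rw [Int.floor_add_intCast, this, zero_add]
  simpa only [e] using this

lemma S_hasSum {α β : ℝ} (hα : 1 < α) (hβ : 0 < β) (hβ' : β < 1) (h : 1 < (1 - β) * α)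
    (n : ℕ) (hn : 0 < n) :
    HasSum (fun i : ℤ => |cc β n i| ^ α) ((n:ℝ) ^ (β * α + 1) *
      ∫ x : ℝ, (cc β n ⌊(n:ℝ) * x⌋ / (n:ℝ) ^ β) ^ α) := by
  have hn' : (0:ℝ) < n := by exact_mod_cast hn
  have hi := hn_integrable hα hβ hβ' h n hn
  have hi2 : Integrable (fun x : ℝ => (cc β n ⌊x⌋ / (n:ℝ) ^ β) ^ α) :=
    (integrable_comp_mul_left_iff (fun x : ℝ => (cc β n ⌊x⌋ / (n:ℝ) ^ β) ^ α) hn'.ne').1 hi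
  have hs := hasSum_floor (fun i => (cc β n i / (n:ℝ) ^ β) ^ α) hi2
  have e := Measure.integral_comp_mul_left (fun x : ℝ => (cc β n ⌊x⌋ / (n:ℝ) ^ β) ^ α) (n:ℝ)
  have hs2 := hs.mul_left ((n:ℝ) ^ (β * α))
  have e1 : ∀ i : ℤ, (n:ℝ) ^ (β * α) * (cc β n i / (n:ℝ) ^ β) ^ α = |cc β n i| ^ α := by
    intro i
    rw [abs_of_nonneg (cc_nonneg hβ _ _), Real.div_rpow (cc_nonneg hβ _ _) (by positivity),
      ← Real.rpow_mul hn'.le]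
    have : 0 < (n:ℝ) ^ (β * α) := by positivity
    field_simp
  have e2 : (n:ℝ) ^ (β * α) * ∫ x : ℝ, (cc β n ⌊x⌋ / (n:ℝ) ^ β) ^ α = (n:ℝ) ^ (β * α + 1) *
      ∫ x : ℝ, (cc β n ⌊(n:ℝ) * x⌋ / (n:ℝ) ^ β) ^ α := by
    rw [e, Real.rpow_add_one hn'.ne', abs_of_pos (by positivity), smul_eq_mul]
    field_simp
  rw [e2] at hs2
  simpa only [e1] using hs2

lemma gl_integrable {α β : ℝ} (hα : 1 < α) (hβ : 0 < β) (hβ' : β < 1) (h : 1 < (1 - β) * α) :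
    Integrable (fun x : ℝ => (1 / (β * Real.Gamma β)) ^ α * gl β x ^ α) := by
  have hG := Real.Gamma_pos_of_pos hβ
  obtain ⟨H, hH, hb⟩ := dom hα hβ hβ' h
  refine hH.mono' (Measurable.aestronglyMeasurable (by unfold gl; fun_prop)) ?_
  filter_upwards [ae_ne01] with x hx
  rw [Real.norm_of_nonneg (mul_nonneg (by positivity) (Real.rpow_nonneg (gl_nonneg hβ x) _))]
  refine le_of_tendsto (pow_scaled hα hβ x hx.1 hx.2) ?_
  filter_upwards [eventually_gt_atTop 0] with n hn using hb n x hn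

lemma gl_pow_integrable {α β : ℝ} (hα : 1 < α) (hβ : 0 < β) (hβ' : β < 1)
    (h : 1 < (1 - β) * α) : Integrable (fun x : ℝ => gl β x ^ α) := by
  have hG := Real.Gamma_pos_of_pos hβ
  have hk : (0:ℝ) < (1 / (β * Real.Gamma β)) ^ α := by positivity
  exact (integrable_const_mul_iff hk.ne'.isUnit _).1 (gl_integrable hα hβ hβ' h)

lemma gl_integral {α β : ℝ} (hα : 1 < α) (hβ : 0 < β) :
    ∫ x : ℝ, gl β x ^ α =
      ∫ x in Set.Iic (1:ℝ), ((1 - x) ^ β - (max (-x) 0) ^ β) ^ α := by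
  have e : ∫ x in Set.Iic (1:ℝ), ((1 - x) ^ β - (max (-x) 0) ^ β) ^ α
      = ∫ x in Set.Iic (1:ℝ), gl β x ^ α := by
    refine setIntegral_congr_fun measurableSet_Iic fun x hx => ?_
    simp only [Set.mem_Iic] at hx
    simp only [gl]
    rw [max_eq_left (show 0 ≤ 1 - x by linarith)]
  rw [e, setIntegral_eq_integral_of_forall_compl_eq_zero]
  intro x hx
  simp only [Set.mem_Iic, not_le] at hx
  unfold gl
  rw [max_eq_right (by linarith), max_eq_right (by linarith), sub_self,
    Real.zero_rpow (by linarith)]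

lemma gl_integral_pos {α β : ℝ} (hα : 1 < α) (hβ : 0 < β) (hβ' : β < 1)
    (h : 1 < (1 - β) * α) : 0 < ∫ x : ℝ, gl β x ^ α := by
  rw [integral_pos_iff_support_of_nonneg (fun x => Real.rpow_nonneg (gl_nonneg hβ x) _)
    (gl_pow_integrable hα hβ hβ' h)]
  have hs : Set.Ioo (0:ℝ) 1 ⊆ Function.support (fun x : ℝ => gl β x ^ α) := by
    intro x hx
    have h1 : 0 < gl β x := by
      unfold gl
      rw [max_eq_right (show -x ≤ 0 by linarith [hx.1]), Real.zero_rpow hβ.ne', sub_zero]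
      have : 0 < max (1 - x) 0 := lt_max_of_lt_left (by linarith [hx.2])
      positivity
    exact (Real.rpow_pos_of_pos h1 _).ne'
  refine lt_of_lt_of_le ?_ (measure_mono hs)
  simp

lemma S_tendsto {α β : ℝ} (hα : 1 < α) (hβ : 0 < β) (hβ' : β < 1) (h : 1 < (1 - β) * α) :
    Tendsto (fun n : ℕ => (∑' i : ℤ, |cc β n i| ^ α) / (n:ℝ) ^ (β * α + 1)) atTop
      (𝓝 ((1 / (β * Real.Gamma β)) ^ α * ∫ x : ℝ, gl β x ^ α)) := by
  obtain ⟨H, hH, hb⟩ := dom hα hβ hβ' h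
  have key : Tendsto (fun n : ℕ => ∫ x : ℝ, (cc β (n+1) ⌊((n+1:ℕ):ℝ) * x⌋ / ((n+1:ℕ):ℝ) ^ β) ^ α)
      atTop (𝓝 (∫ x : ℝ, (1 / (β * Real.Gamma β)) ^ α * gl β x ^ α)) := by
    refine tendsto_integral_of_dominated_convergence H
      (fun n => (meas (n+1)).aestronglyMeasurable) hH (fun n => ae_of_all _ fun x => ?_) ?_
    · rw [Real.norm_of_nonneg
        (Real.rpow_nonneg (div_nonneg (cc_nonneg hβ _ _) (by positivity)) _)]
      exact hb (n+1) x n.succ_pos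
    · filter_upwards [ae_ne01] with x hx
      exact (pow_scaled hα hβ x hx.1 hx.2).comp (tendsto_add_atTop_nat 1)
  rw [integral_const_mul] at key
  rw [← tendsto_add_atTop_iff_nat 1]
  refine key.congr fun n => ?_
  rw [(S_hasSum hα hβ hβ' h (n+1) n.succ_pos).tsum_eq]
  have : (0:ℝ) < ((n+1:ℕ):ℝ) ^ (β * α + 1) := by positivity
  field_simp

lemma b_prod {β₁ β₂ : ℝ} (a : ℤ × ℤ → ℝ)
    (ha : ∀ j : ℤ × ℤ, a j = if 0 ≤ j.1 ∧ 0 ≤ j.2 then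
        Real.Gamma ((j.1 : ℝ) + β₁) * Real.Gamma ((j.2 : ℝ) + β₂) /
          (Real.Gamma β₁ * Real.Gamma β₂ *
            (j.1.toNat.factorial : ℝ) * (j.2.toNat.factorial : ℝ))
      else 0) (n : ℕ) (i : ℤ × ℤ) :
    ∑ j ∈ (Finset.Icc (0:ℤ) (n:ℤ)) ×ˢ (Finset.Icc (0:ℤ) (n:ℤ)), a (j.1 - i.1, j.2 - i.2)
      = cc β₁ n i.1 * cc β₂ n i.2 := by
  have h : ∀ p q : ℤ, a (p, q) = wc β₁ p * wc β₂ q := by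
    intro p q
    rw [ha]
    unfold wc
    by_cases hp : 0 ≤ p <;> by_cases hq : 0 ≤ q <;> simp only [hp, hq, and_self, and_true,
      and_false, if_true, if_false, mul_zero, zero_mul]
    rw [div_mul_div_comm]
    congr 1; ring
  unfold cc
  rw [Finset.sum_mul_sum, Finset.sum_product]
  simp only [h]

/-- for the spatial fractional ARIMA model, the normalizer satisfies
`B_n ~ C₀ n^{β₁+β₂+2/α}` (case `L ≡ 1`). -/
theorem stmt16
    (α β₁ β₂ : ℝ) (hα : 1 < α) (hα2 : α ≤ 2)
    (hβ₁ : 0 < β₁) (hβ₁' : β₁ < 1) (hβ₂ : 0 < β₂) (hβ₂' : β₂ < 1)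
    (h1 : 1 < (1 - β₁) * α) (h2 : 1 < (1 - β₂) * α)
    -- the coefficients `a_{j₁,j₂} = Γ(j₁+β₁)Γ(j₂+β₂)/(Γ(β₁)Γ(β₂) j₁! j₂!)`
    (a : ℤ × ℤ → ℝ)
    (ha : ∀ j : ℤ × ℤ, a j = if 0 ≤ j.1 ∧ 0 ≤ j.2 then
        Real.Gamma ((j.1 : ℝ) + β₁) * Real.Gamma ((j.2 : ℝ) + β₂) /
          (Real.Gamma β₁ * Real.Gamma β₂ *
            (j.1.toNat.factorial : ℝ) * (j.2.toNat.factorial : ℝ))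
      else 0)
    -- `b_{ni} = Σ_{j ∈ Γ_n²} a_{j-i}` with `Γ_n² = [0,n]² ∩ ℤ²`
    (b : ℕ → ℤ × ℤ → ℝ)
    (hb : ∀ (n : ℕ) (i : ℤ × ℤ),
      b n i = ∑ j ∈ (Finset.Icc (0:ℤ) (n:ℤ)) ×ˢ (Finset.Icc (0:ℤ) (n:ℤ)),
        a (j.1 - i.1, j.2 - i.2))
    (B : ℕ → ℝ) (hB : ∀ n, B n = (∑' i : ℤ × ℤ, |b n i| ^ α) ^ (1/α)) :
    -- `B_n ~ C₀ n^{β₁+β₂+2/α}` with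
    -- `C₀ = (C/(β₁β₂)) (∫_{-∞}^1 [(1-x)^{β₁} - (-x)₊^{β₁}]^α dx ·
    --                    ∫_{-∞}^1 [(1-x)^{β₂} - (-x)₊^{β₂}]^α dx)^{1/α}`
    ∃ C : ℝ, 0 < C ∧
      Tendsto (fun n : ℕ => B n /
        ((C / (β₁ * β₂)) *
          ((∫ x in Set.Iic (1:ℝ), ((1 - x) ^ β₁ - (max (-x) 0) ^ β₁) ^ α) *
           (∫ x in Set.Iic (1:ℝ), ((1 - x) ^ β₂ - (max (-x) 0) ^ β₂) ^ α)) ^ (1/α) *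
          (n:ℝ) ^ (β₁ + β₂ + 2/α)))
        atTop (nhds 1) := by
  have hG1 := Real.Gamma_pos_of_pos hβ₁
  have hG2 := Real.Gamma_pos_of_pos hβ₂
  have hα0 : 0 < α := by linarith
  refine ⟨1 / (Real.Gamma β₁ * Real.Gamma β₂), by positivity, ?_⟩
  rw [← gl_integral hα hβ₁, ← gl_integral hα hβ₂]
  have p1 := gl_integral_pos hα hβ₁ hβ₁' h1
  have p2 := gl_integral_pos hα hβ₂ hβ₂' h2
  have t := ((S_tendsto hα hβ₁ hβ₁' h1).mul (S_tendsto hα hβ₂ hβ₂' h2)).rpow_const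
    (p := 1/α) (Or.inr (by positivity))
  set I₁ := ∫ x : ℝ, gl β₁ x ^ α
  set I₂ := ∫ x : ℝ, gl β₂ x ^ α
  have hL : ((1 / (β₁ * Real.Gamma β₁)) ^ α * I₁ * ((1 / (β₂ * Real.Gamma β₂)) ^ α * I₂)) ^ (1/α)
      = 1 / (Real.Gamma β₁ * Real.Gamma β₂) / (β₁ * β₂) * (I₁ * I₂) ^ (1/α) := by
    rw [mul_mul_mul_comm, ← Real.mul_rpow (by positivity) (by positivity),
      Real.mul_rpow (by positivity) (by positivity), ← Real.rpow_mul (by positivity),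
      mul_one_div_cancel hα0.ne', Real.rpow_one]
    congr 1
    field_simp
  rw [hL] at t
  have hLpos : 0 < 1 / (Real.Gamma β₁ * Real.Gamma β₂) / (β₁ * β₂) * (I₁ * I₂) ^ (1/α) := by
    positivity
  set L := 1 / (Real.Gamma β₁ * Real.Gamma β₂) / (β₁ * β₂) * (I₁ * I₂) ^ (1/α)
  have t2 := t.div_const L
  rw [div_self hLpos.ne'] at t2
  refine t2.congr' ?_
  filter_upwards [eventually_gt_atTop 0] with n hn
  have hn' : (0:ℝ) < n := by exact_mod_cast hn
  have s1 := (S_hasSum hα hβ₁ hβ₁' h1 n hn).summable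
  have s2 := (S_hasSum hα hβ₂ hβ₂' h2 n hn).summable
  have n1 : ∀ i, 0 ≤ |cc β₁ n i| ^ α := fun i => by positivity
  have n2 : ∀ i, 0 ≤ |cc β₂ n i| ^ α := fun i => by positivity
  have e : ∑' i : ℤ × ℤ, |b n i| ^ α =
      (∑' i, |cc β₁ n i| ^ α) * ∑' i, |cc β₂ n i| ^ α := by
    rw [s1.tsum_mul_tsum s2 (s1.mul_of_nonneg s2 n1 n2)]
    refine tsum_congr fun i => ?_
    rw [hb, b_prod a ha, abs_mul, Real.mul_rpow (abs_nonneg _) (abs_nonneg _)]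
  have q1 : 0 ≤ ∑' i, |cc β₁ n i| ^ α := tsum_nonneg n1
  have q2 : 0 ≤ ∑' i, |cc β₂ n i| ^ α := tsum_nonneg n2
  rw [hB, e, div_mul_div_comm, Real.div_rpow (by positivity) (by positivity),
    ← Real.rpow_add hn', ← Real.rpow_mul hn'.le, div_div, mul_comm L]
  congr 3
  field_simp
  ring

end
end

section
/- Let d ≥ 1, β > 0, α ∈ (0,2], c_1, …, c_d > 0, and let I = Π_{l=1}^d [−c_l, c_l] ⊂ ℝ^d. Then ∫_{ℝ^d} | ∫_I ‖x − y‖^{−β} dx |^α dy < ∞ if and only if β < d and αβ > d, where ‖·‖ is the Euclidean norm on ℝ^d. -/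
open MeasureTheory Filter Topology

lemma aux_integrable_iff {X : Type*} [MeasurableSpace X] {μ : Measure X} {f : X → ℝ}
    (hf : Measurable f) (h0 : ∀ x, 0 ≤ f x) :
    (∫⁻ x, ENNReal.ofReal (f x) ∂μ) < ⊤ ↔ Integrable f μ := by
  rw [← hasFiniteIntegral_iff_ofReal (Eventually.of_forall h0)]
  exact ⟨fun h => ⟨hf.aestronglyMeasurable, h⟩, fun h => h.2⟩

lemma aux_nontrivial (d : ℕ) (hd : 0 < d) : Nontrivial (EuclideanSpace ℝ (Fin d)) := by
  have : Nonempty (Fin d) := ⟨⟨0, hd⟩⟩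
  infer_instance

lemma aux_ball (d : ℕ) (hd : 0 < d) (β r : ℝ) (hr : 0 < r) :
    (∫⁻ x in Metric.ball (0 : EuclideanSpace ℝ (Fin d)) r, ENNReal.ofReal (‖x‖ ^ (-β))) < ⊤
      ↔ β < d := by
  have := aux_nontrivial d hd
  rw [aux_integrable_iff (by fun_prop) (fun x => by positivity)]
  have h := integrableOn_fun_norm_addHaar (E := EuclideanSpace ℝ (Fin d)) (μ := volume)
    (f := fun t : ℝ => t ^ (-β)) (r := r)
  rw [IntegrableOn] at h
  rw [h, finrank_euclideanSpace_fin]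
  have h2 : IntegrableOn (fun y : ℝ => y ^ (d - 1) • y ^ (-β)) (Set.Ioo 0 r) ↔
      IntegrableOn (fun y : ℝ => y ^ ((d : ℝ) - 1 - β)) (Set.Ioo 0 r) := by
    refine integrableOn_congr_fun (fun y hy => ?_) measurableSet_Ioo
    have hy0 : 0 < y := hy.1
    simp only [smul_eq_mul]
    rw [← Real.rpow_natCast, ← Real.rpow_add hy0, Nat.cast_sub (by omega)]
    congr 1; push_cast; ring
  rw [h2, intervalIntegral.integrableOn_Ioo_rpow_iff hr]
  constructor <;> intro h <;> linarith

lemma aux_tail (d : ℕ) (hd : 0 < d) (γ : ℝ) (hγ : 0 < γ)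
    (hfin : (∫⁻ y : EuclideanSpace ℝ (Fin d), ENNReal.ofReal ((1 + ‖y‖) ^ (-γ))) < ⊤) :
    (d : ℝ) < γ := by
  have := aux_nontrivial d hd
  rw [aux_integrable_iff (by fun_prop) (fun x => by positivity)] at hfin
  have h := (integrable_fun_norm_addHaar (E := EuclideanSpace ℝ (Fin d)) (μ := volume)
    (f := fun t : ℝ => (1 + t) ^ (-γ))).1 hfin
  rw [finrank_euclideanSpace_fin] at h
  have h1 := (h.mono_set (Set.Ioi_subset_Ioi zero_le_one)).const_mul ((2:ℝ) ^ γ)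
  have h2 : IntegrableOn (fun y : ℝ => y ^ ((d : ℝ) - 1 - γ)) (Set.Ioi 1) := by
    refine Integrable.mono' h1 (by fun_prop) ?_
    refine (ae_restrict_iff' measurableSet_Ioi).2 (Eventually.of_forall fun y hy => ?_)
    have hy1 : 1 < y := hy
    have hy0 : 0 < y := by linarith
    rw [Real.norm_of_nonneg (by positivity)]
    have e : y ^ ((d : ℝ) - 1 - γ) = y ^ (d - 1) * y ^ (-γ) := by
      rw [← Real.rpow_natCast y (d - 1), ← Real.rpow_add hy0, Nat.cast_sub (by omega)]
      congr 1; push_cast; ring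
    have e2 : (2 * y) ^ (-γ) ≤ (1 + y) ^ (-γ) :=
      Real.rpow_le_rpow_of_nonpos (by linarith) (by linarith) (by linarith)
    have e3 : (2:ℝ) ^ γ * (2 * y) ^ (-γ) = y ^ (-γ) := by
      rw [Real.mul_rpow (by norm_num) hy0.le, ← mul_assoc, ← Real.rpow_add (by norm_num)]
      simp
    rw [e, ← e3, smul_eq_mul]
    calc y ^ (d - 1) * ((2:ℝ) ^ γ * (2 * y) ^ (-γ)) = 2 ^ γ * (y ^ (d - 1) * (2 * y) ^ (-γ)) := by ring
      _ ≤ _ := by gcongr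
  rw [integrableOn_Ioi_rpow_iff zero_lt_one] at h2
  linarith

lemma aux_translate (d : ℕ) (β r : ℝ) (y : EuclideanSpace ℝ (Fin d)) :
    (∫⁻ x in Metric.ball y r, ENNReal.ofReal (‖x - y‖ ^ (-β))) =
     (∫⁻ x in Metric.ball (0 : EuclideanSpace ℝ (Fin d)) r, ENNReal.ofReal (‖x‖ ^ (-β))) := by
  rw [← lintegral_indicator measurableSet_ball, ← lintegral_indicator measurableSet_ball]
  conv_rhs => rw [← lintegral_sub_right_eq_self _ y]
  congr 1; ext x
  simp only [Set.indicator, mem_ball_iff_norm, sub_zero]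

theorem stmt17
    (d : ℕ) (hd : 0 < d) (β α : ℝ) (hβ : 0 < β) (hα : 0 < α) (hα2 : α ≤ 2)
    (c : Fin d → ℝ) (hc : ∀ l, 0 < c l)
    (I : Set (EuclideanSpace ℝ (Fin d)))
    (hI : I = {x | ∀ l, x l ∈ Set.Icc (-(c l)) (c l)}) :
    (∫⁻ y : EuclideanSpace ℝ (Fin d),
        (∫⁻ x in I, ENNReal.ofReal (‖x - y‖ ^ (-β))) ^ α) < ⊤ ↔
      (β < d ∧ (d : ℝ) < α * β) := by
  have hnt := aux_nontrivial d hd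
  have hne : Nonempty (Fin d) := ⟨⟨0, hd⟩⟩
  -- a small ball inside
  obtain ⟨r, hr, hrI⟩ : ∃ r : ℝ, 0 < r ∧ Metric.ball (0 : EuclideanSpace ℝ (Fin d)) r ⊆ I := by
    obtain ⟨l0, hl0⟩ := Finite.exists_min c
    refine ⟨c l0, hc l0, fun x hx => ?_⟩
    rw [hI]
    intro l
    rw [mem_ball_zero_iff] at hx
    have h1 := PiLp.norm_apply_le x l
    rw [Real.norm_eq_abs] at h1
    have h2 := hl0 l
    exact abs_le.1 (by linarith)
  -- a large ball outside
  obtain ⟨R, hR, hIR⟩ : ∃ R : ℝ, 1 ≤ R ∧ ∀ x ∈ I, ‖x‖ ≤ R := by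
    refine ⟨1 + ∑ l, c l, ?_, fun x hx => ?_⟩
    · have := Finset.sum_nonneg (fun l (_ : l ∈ Finset.univ) => (hc l).le)
      linarith
    · rw [hI] at hx
      have h1 : ‖x‖ ≤ ∑ l, ‖x l‖ := by
        conv_lhs => rw [← (EuclideanSpace.basisFun (Fin d) ℝ).sum_repr x]
        refine (norm_sum_le _ _).trans (Finset.sum_le_sum fun l _ => ?_)
        simp [norm_smul]
      have h2 : ∑ l, ‖x l‖ ≤ ∑ l, c l := Finset.sum_le_sum fun l _ => by
        rw [Real.norm_eq_abs]
        exact abs_le.2 (hx l)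
      linarith
  have hIm : MeasurableSet I := by
    rw [hI, Set.setOf_forall]
    refine MeasurableSet.iInter fun l => ?_
    have hm : Measurable fun x : EuclideanSpace ℝ (Fin d) => x l := by fun_prop
    exact hm measurableSet_Icc
  have hIfin : volume I < ⊤ := by
    refine (measure_mono (fun x hx => ?_)).trans_lt
      (measure_ball_lt_top (μ := volume) (x := (0 : EuclideanSpace ℝ (Fin d))) (r := R + 1))
    have := hIR x hx
    rw [mem_ball_zero_iff]; linarith
  have hIpos : 0 < volume I :=
    (Metric.measure_ball_pos volume _ hr).trans_le (measure_mono hrI)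
  have hpow : ∀ (K : ENNReal) (y : EuclideanSpace ℝ (Fin d)),
      (K * ENNReal.ofReal ((1 + ‖y‖) ^ (-β))) ^ α =
        K ^ α * ENNReal.ofReal ((1 + ‖y‖) ^ (-(α * β))) := by
    intro K y
    rw [ENNReal.mul_rpow_of_nonneg _ _ hα.le,
      ENNReal.ofReal_rpow_of_nonneg (by positivity) hα.le, ← Real.rpow_mul (by positivity)]
    congr 3; ring
  constructor
  · intro hfin
    constructor
    · by_contra hcon
      have hball : (∫⁻ x in Metric.ball (0 : EuclideanSpace ℝ (Fin d)) (r/2),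
          ENNReal.ofReal (‖x‖ ^ (-β))) = ⊤ := by
        by_contra h
        exact hcon ((aux_ball d hd β (r/2) (by linarith)).1 (lt_top_iff_ne_top.2 h))
      have hlow : ∀ y ∈ Metric.ball (0 : EuclideanSpace ℝ (Fin d)) (r/2),
          (⊤ : ENNReal) ≤ (∫⁻ x in I, ENNReal.ofReal (‖x - y‖ ^ (-β))) ^ α := by
        intro y hy
        have : (∫⁻ x in I, ENNReal.ofReal (‖x - y‖ ^ (-β))) = ⊤ := by
          rw [eq_top_iff, ← hball, ← aux_translate d β (r/2) y]
          refine lintegral_mono_set (fun x hx => hrI ?_)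
          rw [mem_ball_zero_iff] at *
          rw [mem_ball_iff_norm] at hx
          have := norm_add_le (x - y) y
          rw [sub_add_cancel] at this
          linarith
        rw [this, ENNReal.top_rpow_of_pos hα]
      have h1 : (∫⁻ y in Metric.ball (0 : EuclideanSpace ℝ (Fin d)) (r/2), (⊤ : ENNReal)) < ⊤ :=
        ((setLIntegral_mono' measurableSet_ball hlow).trans
          (setLIntegral_le_lintegral _ _)).trans_lt hfin
      rw [setLIntegral_const, ENNReal.top_mul
        (Metric.measure_ball_pos volume _ (by linarith)).ne'] at h1
      exact lt_irrefl _ h1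
    · refine aux_tail d hd (α * β) (by positivity) ?_
      set K : ENNReal := volume I * ENNReal.ofReal (R ^ (-β)) with hK
      have hK0 : K ≠ 0 := by
        refine mul_ne_zero hIpos.ne' ?_
        rw [Ne, ENNReal.ofReal_eq_zero, not_le]
        positivity
      have hKt : K ≠ ⊤ := ENNReal.mul_ne_top hIfin.ne ENNReal.ofReal_ne_top
      have hlow : ∀ y : EuclideanSpace ℝ (Fin d), K * ENNReal.ofReal ((1 + ‖y‖) ^ (-β)) ≤
          ∫⁻ x in I, ENNReal.ofReal (‖x - y‖ ^ (-β)) := by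
        intro y
        have : K * ENNReal.ofReal ((1 + ‖y‖) ^ (-β)) =
            ∫⁻ x in I, ENNReal.ofReal ((R * (1 + ‖y‖)) ^ (-β)) := by
          rw [setLIntegral_const, hK, Real.mul_rpow (by positivity) (by positivity),
            ENNReal.ofReal_mul (by positivity)]
          ring
        rw [this]
        refine setLIntegral_mono_ae' hIm ?_
        have hae : ∀ᵐ x : EuclideanSpace ℝ (Fin d), x ≠ y := by
          simp [ae_iff]
        filter_upwards [hae] with x hxy hx
        have h1 := hIR x hx
        have h2 := norm_sub_le x y
        have h3 : 0 < ‖x - y‖ := norm_pos_iff.2 (sub_ne_zero.2 hxy)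
        have h4 : 0 ≤ ‖y‖ := norm_nonneg y
        refine ENNReal.ofReal_le_ofReal (Real.rpow_le_rpow_of_nonpos h3 ?_ (by linarith))
        nlinarith
      have h1 : (∫⁻ y : EuclideanSpace ℝ (Fin d),
          K ^ α * ENNReal.ofReal ((1 + ‖y‖) ^ (-(α * β)))) < ⊤ := by
        refine lt_of_le_of_lt (lintegral_mono fun y => ?_) hfin
        rw [← hpow]
        exact ENNReal.rpow_le_rpow (hlow y) hα.le
      rw [lintegral_const_mul' _ _ (ENNReal.rpow_ne_top_of_nonneg hα.le hKt)] at h1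
      refine ENNReal.lt_top_of_mul_ne_top_right h1.ne ?_
      exact (ENNReal.rpow_pos (pos_iff_ne_zero.2 hK0) hKt).ne'
  · rintro ⟨hβd, hαβ⟩
    set A := (∫⁻ x in Metric.ball (0 : EuclideanSpace ℝ (Fin d)) 1,
      ENNReal.ofReal (‖x‖ ^ (-β))) with hA
    have hAfin : A < ⊤ := (aux_ball d hd β 1 one_pos).2 hβd
    have hbdd : ∀ y : EuclideanSpace ℝ (Fin d),
        (∫⁻ x in I, ENNReal.ofReal (‖x - y‖ ^ (-β))) ≤ A + volume I := by
      intro y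
      rw [← lintegral_inter_add_diff (μ := volume) (fun x => ENNReal.ofReal (‖x - y‖ ^ (-β)))
        I (measurableSet_ball (x := y) (ε := 1)), hA, ← aux_translate d β 1 y]
      refine add_le_add (lintegral_mono_set Set.inter_subset_right) ?_
      calc _ ≤ ∫⁻ x in I \ Metric.ball y 1, (1 : ENNReal) := by
            refine setLIntegral_mono' (hIm.diff measurableSet_ball) fun x hx => ?_
            have h1 : 1 ≤ ‖x - y‖ := by
              have := hx.2
              rw [mem_ball_iff_norm, not_lt] at this
              exact this
            rw [ENNReal.ofReal_le_one]
            exact Real.rpow_le_one_of_one_le_of_nonpos h1 (by linarith)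
        _ ≤ volume I := by
            rw [setLIntegral_const, one_mul]
            exact measure_mono Set.diff_subset
    set K : ENNReal := (A + volume I) * ENNReal.ofReal ((1 + 2 * R) ^ β)
      + volume I * ENNReal.ofReal (4 ^ β) with hK
    have hKt : K ≠ ⊤ := by
      refine ENNReal.add_ne_top.2 ⟨ENNReal.mul_ne_top
        (ENNReal.add_ne_top.2 ⟨hAfin.ne, hIfin.ne⟩) ENNReal.ofReal_ne_top,
        ENNReal.mul_ne_top hIfin.ne ENNReal.ofReal_ne_top⟩
    have hup : ∀ y : EuclideanSpace ℝ (Fin d),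
        (∫⁻ x in I, ENNReal.ofReal (‖x - y‖ ^ (-β))) ≤
          K * ENNReal.ofReal ((1 + ‖y‖) ^ (-β)) := by
      intro y
      have h4 : 0 ≤ ‖y‖ := norm_nonneg y
      rw [hK, add_mul, mul_assoc, mul_assoc, ← ENNReal.ofReal_mul (by positivity),
        ← ENNReal.ofReal_mul (by positivity)]
      rcases le_total ‖y‖ (2 * R) with hy | hy
      · refine ((hbdd y).trans ?_).trans le_self_add
        refine le_mul_of_one_le_right (zero_le) ?_
        rw [ENNReal.one_le_ofReal, Real.rpow_neg (by positivity), ← div_eq_mul_inv,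
          one_le_div (by positivity)]
        exact Real.rpow_le_rpow (by positivity) (by linarith) hβ.le
      · refine le_trans ?_ le_add_self
        have : (4:ℝ) ^ β * (1 + ‖y‖) ^ (-β) = ((1 + ‖y‖) / 4) ^ (-β) := by
          rw [Real.div_rpow (by positivity) (by norm_num), Real.rpow_neg (by norm_num : (0:ℝ) ≤ 4),
            div_inv_eq_mul, mul_comm]
        rw [this, mul_comm, ← setLIntegral_const]
        refine setLIntegral_mono' hIm fun x hx => ?_
        have h1 := hIR x hx
        have h2 := norm_sub_norm_le y x
        rw [norm_sub_rev] at h2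
        refine ENNReal.ofReal_le_ofReal (Real.rpow_le_rpow_of_nonpos (by positivity) ?_ (by linarith))
        linarith
    calc _ ≤ ∫⁻ y : EuclideanSpace ℝ (Fin d),
          K ^ α * ENNReal.ofReal ((1 + ‖y‖) ^ (-(α * β))) := by
          refine lintegral_mono fun y => ?_
          rw [← hpow]
          exact ENNReal.rpow_le_rpow (hup y) hα.le
      _ < ⊤ := by
          rw [lintegral_const_mul' _ _ (ENNReal.rpow_ne_top_of_nonneg hα.le hKt)]
          refine ENNReal.mul_lt_top (ENNReal.rpow_lt_top_of_nonneg hα.le hKt) ?_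
          exact finite_integral_one_add_norm (by rw [finrank_euclideanSpace_fin]; exact hαβ)
end
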